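/- arXiv:1908.02253 — 2 statements merged into one kernel-verified Lean document; each statement's English description precedes it below -/
import Mathlib

section
/- Let k ≥ 1 and n ≥ 1 be integers, let A be a subset of [k]^n, and let B be an initial segment of the ≤-order on [k]^n with |B| = |A|. Then |d(A)| ≥ |d(B)|. -/
open Finset
open scoped Classical

/-- `R_i(x)`: the set of coordinates of `x` equal to `i`.
The ambient alphabet is `[k+1] = {0,…,k}`. -/
noncomputable def rset {k N : ℕ} (x : Fin N → Fin (k + 1)) (i : ℕ) : Finset (Fin N) :=
  Finset.univ.filter fun j => (x j : ℕ) = i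

/-- the strict binary order on finite sets of coordinates:
`X <_bin Y` iff `X ≠ Y` and `max (X Δ Y) ∈ Y`. -/
def binLT {N : ℕ} (X Y : Finset (Fin N)) : Prop :=
  ∃ m ∈ Y, m ∉ X ∧ ∀ j : Fin N, ((j ∈ X ∧ j ∉ Y) ∨ (j ∈ Y ∧ j ∉ X)) → j ≤ m

/-- the strict `≤`-order on `[k+1]^N`: `x < y` iff `|R_0(x)| > |R_0(y)|`, or
`|R_0(x)| = |R_0(y)|` and for the largest `i` with `R_i(x) ≠ R_i(y)` we have
`max (R_i(x) Δ R_i(y)) ∈ R_i(y)`. -/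
def plt {k N : ℕ} (x y : Fin N → Fin (k + 1)) : Prop :=
  (rset y 0).card < (rset x 0).card ∨
    ((rset x 0).card = (rset y 0).card ∧
      ∃ i : ℕ, binLT (rset x i) (rset y i) ∧ ∀ j : ℕ, i < j → rset x j = rset y j)

/-- the `≤`-order on `[k+1]^N`. -/
def ple {k N : ℕ} (x y : Fin N → Fin (k + 1)) : Prop := x = y ∨ plt x y

/-- `B` is an initial segment of the `≤`-order. -/
def isInitSeg {k N : ℕ} (B : Finset (Fin N → Fin (k + 1))) : Prop :=
  ∀ y ∈ B, ∀ x, ple x y → x ∈ B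

/-- the `d`-shadow: all points obtained from a point of `A` by flipping one
nonzero coordinate to `0`. -/
noncomputable def dShadow {k N : ℕ} (A : Finset (Fin N → Fin (k + 1))) :
    Finset (Fin N → Fin (k + 1)) :=
  A.biUnion fun x =>
    (Finset.univ.filter fun i => x i ≠ 0).image fun i => Function.update x i 0

/-- the initial segment of the `≤`-order on `[k+1]^N` of cardinality `m`. -/
noncomputable def initSeg (k N m : ℕ) : Finset (Fin N → Fin (k + 1)) :=
  Finset.univ.filter fun x => (Finset.univ.filter fun y => ple y x).card ≤ m

/-- the `C_s`-compression of `A ⊆ [k+1]^(n+1)`: replace each slice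
`A_{s,t} = {y : t_s y ∈ A}` by the initial segment of the same size. -/
noncomputable def compress {k n : ℕ} (s : Fin (n + 1)) (A : Finset (Fin (n + 1) → Fin (k + 1))) :
    Finset (Fin (n + 1) → Fin (k + 1)) :=
  Finset.univ.biUnion fun t : Fin (k + 1) =>
    (initSeg k n
        (Finset.univ.filter fun y : Fin n → Fin (k + 1) => s.insertNth t y ∈ A).card).image
      fun y => s.insertNth t y

/-- `A` is compressed if every `C_s`-compression fixes it. -/
def IsCompressed {k n : ℕ} (A : Finset (Fin (n + 1) → Fin (k + 1))) : Prop :=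
  ∀ s : Fin (n + 1), compress s A = A

/-- `B_r`: points with exactly `r` zero coordinates. -/
noncomputable def Bexact (k N r : ℕ) : Finset (Fin N → Fin (k + 1)) :=
  Finset.univ.filter fun x => (rset x 0).card = r

/-- `B_{≥r}`: points with at least `r` zero coordinates. -/
noncomputable def Bge (k N r : ℕ) : Finset (Fin N → Fin (k + 1)) :=
  Finset.univ.filter fun x => r ≤ (rset x 0).card

/-- `m(x)`: the largest coordinate value of `x`. -/
noncomputable def mval {k N : ℕ} (x : Fin N → Fin (k + 1)) : ℕ :=
  Finset.univ.sup fun i => (x i : ℕ)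

/-- the class `C_X`: points with maximal coordinate `s`, attained exactly on `X`,
and exactly `r` zero coordinates. -/
noncomputable def classSet (k N s r : ℕ) (X : Finset (Fin N)) : Finset (Fin N → Fin (k + 1)) :=
  Finset.univ.filter fun x => mval x = s ∧ rset x s = X ∧ (rset x 0).card = r

/-- `[m]^N = {0,…,m−1}^N`. -/
noncomputable def box (k N m : ℕ) : Finset (Fin N → Fin (k + 1)) :=
  Finset.univ.filter fun x => ∀ i, (x i : ℕ) < m

/-- `{1,…,s−1}^N`. -/
noncomputable def box1 (k N s : ℕ) : Finset (Fin N → Fin (k + 1)) :=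
  Finset.univ.filter fun x => ∀ i, 1 ≤ (x i : ℕ) ∧ (x i : ℕ) ≤ s - 1

/-- `B` is a down-set. -/
def isDownSet {k N : ℕ} (B : Finset (Fin N → Fin (k + 1))) : Prop :=
  ∀ y ∈ B, ∀ x : Fin N → Fin (k + 1), (∀ j, (x j : ℕ) ≤ (y j : ℕ)) → x ∈ B


namespace ShadowAux

/-- number of zeros -/
noncomputable def zc {k N : ℕ} (x : Fin N → Fin (k + 1)) : ℕ := (rset x 0).card

/-- strong top-difference relation -/
def TS {k N : ℕ} (x y : Fin N → Fin (k + 1)) (q : Fin N) : Prop :=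
  x q ≠ y q ∧ ∀ j, x j ≠ y j →
    ((x j : ℕ) < y q ∨ ((x j : ℕ) = y q ∧ j < q)) ∧ ((y j : ℕ) < y q ∨ ((y j : ℕ) = y q ∧ j ≤ q))

/-- weak top-difference relation -/
def TW {k N : ℕ} (x y : Fin N → Fin (k + 1)) (q : Fin N) : Prop :=
  x q ≠ y q ∧ ∀ j, x j ≠ y j →
    ((x j : ℕ) < y q ∨ ((x j : ℕ) = y q ∧ j < q))

lemma TW_to_TS {k N : ℕ} {x y : Fin N → Fin (k + 1)} {q : Fin N} (h : TW x y q) :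
    ∃ q', TS x y q' := by
  let D := Finset.univ.filter fun j => x j ≠ y j
  have hD : D.Nonempty := ⟨q, by simp [D, h.1]⟩
  obtain ⟨p, hp, hmax⟩ := D.exists_max_image (fun j => toLex (y j, j)) hD
  have hp' : x p ≠ y p := by simpa [D] using hp
  have key : ∀ j, x j ≠ y j → ((y j : ℕ) < y p ∨ ((y j : ℕ) = y p ∧ j ≤ p)) := by
    intro j hj
    have := hmax j (by simp [D, hj])
    rw [Prod.Lex.toLex_le_toLex] at this
    rcases this with h1 | ⟨h1, h2⟩
    · left; exact h1
    · right; exact ⟨congrArg _ h1, h2⟩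
  refine ⟨p, hp', fun j hj => ⟨?_, key j hj⟩⟩
  have h1 := key q h.1
  have h2 := h.2 j hj
  simp only [Fin.lt_def, Fin.le_def] at *
  omega

lemma plt_iff_TS {k N : ℕ} (x y : Fin N → Fin (k + 1)) :
    plt x y ↔ zc y < zc x ∨ (zc x = zc y ∧ ∃ q, TS x y q) := by
  unfold plt zc
  refine or_congr Iff.rfl (and_congr_right fun _ => ?_)
  constructor
  · rintro ⟨i, ⟨m, hm, hm', hb⟩, hi⟩
    simp only [rset, mem_filter, mem_univ, true_and] at hm hm' hb
    have hj : ∀ j l, i < l → ((x j : ℕ) = l ↔ (y j : ℕ) = l) := by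
      intro j l hl
      have := hi l hl
      have := congrArg (fun s => j ∈ s) this
      simpa [rset] using this
    refine ⟨m, fun e => hm' (by rw [e, hm]), fun j hne => ?_⟩
    have hne' : (x j : ℕ) ≠ y j := fun e => hne (Fin.ext e)
    have h1 : ¬ i < (x j : ℕ) := fun h => hne' ((hj j _ h).1 rfl).symm
    have h2 : ¬ i < (y j : ℕ) := fun h => hne' ((hj j _ h).2 rfl)
    have h3 := hb j
    have h4 : (j : ℕ) = m → (x j : ℕ) ≠ i := by intro e; rw [Fin.ext e]; exact hm'
    rw [hm]
    simp only [Fin.lt_def, Fin.le_def] at h3 ⊢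
    omega
  · rintro ⟨q, hq, h⟩
    refine ⟨y q, ⟨q, by simp [rset], ?_, ?_⟩, ?_⟩
    · simp only [rset, mem_filter, mem_univ, true_and]
      intro e; exact hq (Fin.ext e)
    · intro j hj
      simp only [rset, mem_filter, mem_univ, true_and] at hj
      have := h j (by intro e; rw [e] at hj; tauto)
      simp only [Fin.lt_def, Fin.le_def] at *
      omega
    · intro l hl
      ext j
      simp only [rset, mem_filter, mem_univ, true_and]
      by_cases e : x j = y j
      · rw [e]
      · have := h j e
        omega

lemma plt_of_TW {k N : ℕ} {x y : Fin N → Fin (k + 1)} (q : Fin N) (hz : zc x = zc y)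
    (h : TW x y q) : plt x y :=
  (plt_iff_TS x y).2 (Or.inr ⟨hz, TW_to_TS h⟩)

/-- linear key -/
noncomputable def cx {k N : ℕ} (x : Fin N → Fin (k + 1)) : Colex (Finset (Fin (k+1) ×ₗ Fin N)) :=
  toColex (Finset.univ.image fun j => toLex (x j, j))

lemma mem_cx {k N : ℕ} (x : Fin N → Fin (k + 1)) (v : Fin (k+1)) (j : Fin N) :
    toLex (v, j) ∈ (Finset.univ.image fun j => toLex (x j, j)) ↔ x j = v := by
  simp only [mem_image, mem_univ, true_and, EmbeddingLike.apply_eq_iff_eq, Prod.mk.injEq]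
  constructor
  · rintro ⟨a, h, rfl⟩; exact h
  · intro h; exact ⟨j, h, rfl⟩

lemma cx_lt {k N : ℕ} (x y : Fin N → Fin (k + 1)) : cx x < cx y ↔ ∃ q, TW x y q := by
  unfold cx
  rw [Finset.Colex.toColex_lt_toColex_iff_exists_forall_lt]
  constructor
  · rintro ⟨a, ha, ha', hb⟩
    obtain ⟨q, -, rfl⟩ := mem_image.1 ha
    rw [mem_cx] at ha'
    refine ⟨q, ha', fun j hj => ?_⟩
    have := hb (toLex (x j, j)) ((mem_cx _ _ _).2 rfl) (by rw [mem_cx]; exact fun e => hj e.symm)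
    rw [Prod.Lex.toLex_lt_toLex] at this
    rcases this with h1 | ⟨h1, h2⟩
    · left; exact h1
    · right; exact ⟨congrArg _ h1, h2⟩
  · rintro ⟨q, hq, h⟩
    refine ⟨toLex (y q, q), (mem_cx _ _ _).2 rfl, by rw [mem_cx]; exact hq, ?_⟩
    intro b hb hb'
    obtain ⟨j, -, rfl⟩ := mem_image.1 hb
    rw [mem_cx] at hb'
    have := h j (fun e => hb' e.symm)
    rw [Prod.Lex.toLex_lt_toLex]
    rcases this with h1 | ⟨h1, h2⟩
    · left; exact h1
    · right; exact ⟨Fin.ext h1, h2⟩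

lemma cx_inj {k N : ℕ} {x y : Fin N → Fin (k + 1)} (h : cx x = cx y) : x = y := by
  funext j
  have h' : (Finset.univ.image fun j => toLex (x j, j)) = (Finset.univ.image fun j => toLex (y j, j)) :=
    toColex_inj.1 h
  have : toLex (y j, j) ∈ (Finset.univ.image fun j => toLex (x j, j)) := by
    rw [h', mem_cx]
  exact (mem_cx _ _ _).1 this

lemma plt_iff_cx {k N : ℕ} (x y : Fin N → Fin (k + 1)) :
    plt x y ↔ zc y < zc x ∨ (zc x = zc y ∧ cx x < cx y) := by
  rw [plt_iff_TS, cx_lt]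
  refine or_congr Iff.rfl (and_congr_right fun _ => ⟨?_, ?_⟩)
  · rintro ⟨q, h⟩; exact ⟨q, h.1, fun j hj => (h.2 j hj).1⟩
  · rintro ⟨q, h⟩; exact TW_to_TS h

lemma plt_irrefl {k N : ℕ} (x : Fin N → Fin (k + 1)) : ¬ plt x x := by
  rw [plt_iff_cx]; simp

lemma plt_trans {k N : ℕ} {x y z : Fin N → Fin (k + 1)} (h : plt x y) (h' : plt y z) : plt x z := by
  rw [plt_iff_cx] at *
  rcases h with h | ⟨h, h1⟩ <;> rcases h' with h' | ⟨h', h1'⟩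
  · left; omega
  · left; omega
  · left; omega
  · right; exact ⟨by omega, h1.trans h1'⟩

lemma plt_total {k N : ℕ} (x y : Fin N → Fin (k + 1)) : plt x y ∨ x = y ∨ plt y x := by
  rw [plt_iff_cx, plt_iff_cx]
  rcases lt_trichotomy (zc x) (zc y) with h | h | h
  · right; right; left; exact h
  · rcases lt_trichotomy (cx x) (cx y) with h1 | h1 | h1
    · left; right; exact ⟨h, h1⟩
    · right; left; exact cx_inj h1
    · right; right; right; exact ⟨h.symm, h1⟩
  · left; left; exact h

/-- rank -/
noncomputable def wt {k N : ℕ} (x : Fin N → Fin (k + 1)) : ℕ := (univ.filter fun z => plt z x).card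

lemma wt_lt {k N : ℕ} {x y : Fin N → Fin (k + 1)} (h : plt x y) : wt x < wt y := by
  apply Finset.card_lt_card
  rw [Finset.ssubset_iff_of_subset]
  · exact ⟨x, by simpa using h, by simpa using plt_irrefl x⟩
  · intro z hz
    simp only [mem_filter, mem_univ, true_and] at *
    exact plt_trans hz h

lemma plt_of_wt {k N : ℕ} {x y : Fin N → Fin (k + 1)} (h : wt x < wt y) : plt x y := by
  rcases plt_total x y with h1 | rfl | h1
  · exact h1
  · omega
  · have := wt_lt h1; omega

lemma plt_zc {k N : ℕ} {x y : Fin N → Fin (k + 1)} (h : plt x y) : zc y ≤ zc x := by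
  rw [plt_iff_cx] at h; omega

lemma plt_of_zc {k N : ℕ} {x y : Fin N → Fin (k + 1)} (h : zc y < zc x) : plt x y := Or.inl h

/-- sums over initial segments are minimal -/
lemma wsum {k N : ℕ} (g : (Fin N → Fin (k + 1)) → ℕ) (A B : Finset (Fin N → Fin (k + 1)))
    (hc : B.card = A.card) (h : ∀ b ∈ B, b ∉ A → ∀ a ∈ A, a ∉ B → g b < g a) (hne : B ≠ A) :
    ∑ x ∈ B, g x < ∑ x ∈ A, g x := by
  have e1 : ∑ x ∈ B, g x = ∑ x ∈ B ∩ A, g x + ∑ x ∈ B \ A, g x :=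
    (Finset.sum_inter_add_sum_sdiff B A g).symm
  have e2 : ∑ x ∈ A, g x = ∑ x ∈ A ∩ B, g x + ∑ x ∈ A \ B, g x :=
    (Finset.sum_inter_add_sum_sdiff A B g).symm
  rw [e1, e2, inter_comm]
  have hcd : (B \ A).card = (A \ B).card := by
    have h1 := Finset.card_sdiff_add_card_inter B A
    have h2 := Finset.card_sdiff_add_card_inter A B
    rw [inter_comm] at h2
    omega
  have hne' : (B \ A).Nonempty := by
    rw [Finset.sdiff_nonempty]
    intro hs
    exact hne (Finset.eq_of_subset_of_card_le hs hc.ge)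
  obtain ⟨b, hb, hbm⟩ := (B \ A).exists_max_image g hne'
  rw [mem_sdiff] at hb
  have h1 : ∑ x ∈ B \ A, g x ≤ (B \ A).card • g b := Finset.sum_le_card_nsmul _ _ _ hbm
  have h2 : (A \ B).card • (g b + 1) ≤ ∑ x ∈ A \ B, g x := by
    apply Finset.card_nsmul_le_sum
    intro x hx
    rw [mem_sdiff] at hx
    exact h b hb.1 hb.2 x hx.1 hx.2
  have h3 : 0 < (B \ A).card := hne'.card_pos
  rw [← hcd] at h2
  simp only [smul_eq_mul] at h1 h2
  nlinarith

lemma initseg_sep {k N : ℕ} {B : Finset (Fin N → Fin (k + 1))} (hB : isInitSeg B)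
    {a b : Fin N → Fin (k + 1)} (hb : b ∈ B) (ha : a ∉ B) : plt b a := by
  rcases plt_total b a with h | rfl | h
  · exact h
  · exact absurd hb ha
  · exact absurd (hB b hb a (Or.inr h)) ha

lemma initseg_unique {k N : ℕ} {B B' : Finset (Fin N → Fin (k + 1))} (hB : isInitSeg B)
    (hB' : isInitSeg B') (hc : B.card = B'.card) : B = B' := by
  by_contra hne
  have h1 := wsum wt B' B hc
    (fun b hb hb' a ha ha' => absurd (plt_trans (initseg_sep hB hb ha') (initseg_sep hB' ha hb')) (plt_irrefl _)) hne
  have h2 := wsum wt B B' hc.symm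
    (fun b hb hb' a ha ha' => absurd (plt_trans (initseg_sep hB' hb ha') (initseg_sep hB ha hb')) (plt_irrefl _)) (Ne.symm hne)
  omega

/-- union of initial segments -/
lemma union_init {k N : ℕ} {ι : Type*} (s : Finset ι) (C : ι → Finset (Fin N → Fin (k + 1)))
    (hC : ∀ i ∈ s, isInitSeg (C i)) (M : ℕ) (hM : ∀ i ∈ s, (C i).card ≤ M) :
    (s.biUnion C).card ≤ M := by
  by_cases hne : (s.biUnion C).Nonempty
  · obtain ⟨u, hu, hmax⟩ := (s.biUnion C).exists_max_image wt hne
    obtain ⟨i, hi, hui⟩ := mem_biUnion.1 hu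
    refine le_trans (Finset.card_le_card ?_) (hM i hi)
    intro v hv
    by_contra hvi
    have := wt_lt (initseg_sep (hC i hi) hui hvi)
    have := hmax v hv
    omega
  · rw [not_nonempty_iff_eq_empty] at hne
    simp [hne]

/-! ### updates -/

lemma zc_up0 {k N : ℕ} {x : Fin N → Fin (k + 1)} {i : Fin N} (h : x i ≠ 0) :
    zc (Function.update x i 0) = zc x + 1 := by
  unfold zc
  have : rset (Function.update x i 0) 0 = insert i (rset x 0) := by
    ext j
    by_cases hj : j = i
    · subst hj; simp [rset]
    · simp [rset, hj]
  rw [this, card_insert_of_notMem]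
  simpa [rset] using h

lemma zc_up {k N : ℕ} {x : Fin N → Fin (k + 1)} {i : Fin N} {c : Fin (k+1)} (h : x i = 0) (hc : c ≠ 0) :
    zc (Function.update x i c) + 1 = zc x := by
  have := zc_up0 (x := Function.update x i c) (i := i) (by simpa using hc)
  rw [← this]; congr 1; funext j; by_cases hj : j = i
  · subst hj; simp [h]
  · simp [hj]

lemma zc_upne {k N : ℕ} {x : Fin N → Fin (k + 1)} {i : Fin N} {c : Fin (k+1)} (h : x i ≠ 0) (hc : c ≠ 0) :
    zc (Function.update x i c) = zc x := by
  have h1 := zc_up0 h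
  have h2 := zc_up (x := Function.update x i 0) (i := i) (by simp) hc
  rw [Function.update_idem] at h2
  omega

lemma zc_swap {k N : ℕ} {x : Fin N → Fin (k + 1)} {i p : Fin N} {c : Fin (k+1)} (hi : x i ≠ 0)
    (hp : x p = 0) (hc : c ≠ 0) : zc (Function.update (Function.update x i 0) p c) = zc x := by
  have hne : p ≠ i := by rintro rfl; exact hi hp
  have h1 := zc_up0 hi
  have h2 := zc_up (x := Function.update x i 0) (i := p) (by simp [hne, hp]) hc
  omega

lemma zc_pos {k N : ℕ} {x : Fin N → Fin (k + 1)} {i : Fin N} (h : x i = 0) : 0 < zc x := by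
  unfold zc; apply Finset.card_pos.2; exact ⟨i, by simp [rset, h]⟩

lemma exists_zero {k N : ℕ} {x : Fin N → Fin (k + 1)} (h : zc x ≠ 0) : ∃ p, x p = 0 := by
  obtain ⟨p, hp⟩ := Finset.card_pos.1 (Nat.pos_of_ne_zero h)
  exact ⟨p, by simpa [rset] using hp⟩

lemma zc_le_one {k N : ℕ} {x : Fin N → Fin (k + 1)} (h : zc x ≤ 1) {i j : Fin N} (hi : x i = 0)
    (hj : x j = 0) : i = j :=
  Finset.card_le_one.1 h i (by simp [rset, hi]) j (by simp [rset, hj])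

lemma zc_one {k N : ℕ} {x : Fin N → Fin (k + 1)} {p : Fin N} (h : ∀ j, x j = 0 → j = p) : zc x ≤ 1 := by
  apply Finset.card_le_one.2
  intro a ha b hb
  rw [h a (by simpa [rset] using ha), h b (by simpa [rset] using hb)]

lemma exists_one {k N : ℕ} {x : Fin N → Fin (k + 1)} {i : Fin N} (h : x i ≠ 0) :
    ∃ o : Fin (k+1), (o : ℕ) = 1 ∧ o ≠ 0 := by
  have h1 := (x i).2
  have h2 : (x i : ℕ) ≠ 0 := fun e => h (Fin.ext e)
  refine ⟨⟨1, by omega⟩, rfl, ?_⟩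
  intro e; simpa using congrArg Fin.val e

lemma plt_down {k N : ℕ} {y : Fin N → Fin (k + 1)} {i : Fin N} {c : Fin (k+1)} (h : (c : ℕ) < y i) (hc : c ≠ 0) :
    plt (Function.update y i c) y := by
  have hy : y i ≠ 0 := by intro e; simp [e] at h
  refine plt_of_TW i (zc_upne hy hc) ⟨by simp; rintro rfl; omega, fun j hj => ?_⟩
  by_cases e : j = i
  · subst e; left; simpa using h
  · simp [e] at hj

lemma plt_up {k N : ℕ} {y : Fin N → Fin (k + 1)} {i : Fin N} {c : Fin (k+1)} (h : (y i : ℕ) < c) (hy : y i ≠ 0) :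
    plt y (Function.update y i c) := by
  have := plt_down (y := Function.update y i c) (i := i) (c := y i) (by simpa using h) hy
  simpa using this

lemma mem_dS {k N : ℕ} {A : Finset (Fin N → Fin (k + 1))} {u : Fin N → Fin (k + 1)} :
    u ∈ dShadow A ↔ ∃ a ∈ A, ∃ j, a j ≠ 0 ∧ Function.update a j 0 = u := by
  simp [dShadow]

end ShadowAux

namespace ShadowAux

lemma exists_first_zero {k N : ℕ} {x : Fin N → Fin (k + 1)} (h : zc x ≠ 0) :
    ∃ p, x p = 0 ∧ ∀ j, x j = 0 → p ≤ j := by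
  obtain ⟨p, hp⟩ := exists_zero h
  obtain ⟨q, hq, hm⟩ := (univ.filter fun j => x j = 0).exists_min_image id ⟨p, by simp [hp]⟩
  exact ⟨q, by simpa using hq, fun j hj => hm j (by simp [hj])⟩

lemma mincover_le {k N : ℕ} {y : Fin N → Fin (k + 1)} {i p : Fin N} {o : Fin (k+1)}
    (hi : y i ≠ 0) (ho : (o : ℕ) = 1) (ho0 : o ≠ 0)
    (hp : Function.update y i 0 p = 0) (hpm : ∀ j, Function.update y i 0 j = 0 → p ≤ j) :
    ple (Function.update (Function.update y i 0) p o) y := by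
  have hi' : (y i : ℕ) ≠ 0 := fun e => hi (Fin.ext e)
  by_cases e : p = i
  · subst e
    rw [Function.update_idem]
    by_cases e2 : y p = o
    · left; rw [← e2]; simp
    · right
      apply plt_down _ ho0
      have : (y p : ℕ) ≠ o := fun h => e2 (Fin.ext h)
      omega
  · right
    have hyp : y p = 0 := by simpa [e] using hp
    have hlt : p < i := lt_of_le_of_ne (hpm i (by simp)) e
    refine plt_of_TW i (zc_swap hi hyp ho0) ⟨?_, ?_⟩
    · simp [Ne.symm e, Ne.symm hi]
    · intro j hj
      by_cases h1 : j = p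
      · subst h1
        simp only [Function.update_self, ho]
        have : (y i : ℕ) = 1 ∨ 1 < (y i : ℕ) := by omega
        rcases this with h | h
        · right; exact ⟨h.symm, hlt⟩
        · left; exact h
      · by_cases h2 : j = i
        · subst h2; left; rw [Function.update_of_ne h1, Function.update_self]; simp only [Fin.val_zero]; omega
        · simp [h1, h2] at hj

lemma mincover_mono {k N : ℕ} {w z : Fin N → Fin (k + 1)} {j p q : Fin N} {o : Fin (k+1)}
    (ho : (o : ℕ) = 1) (ho0 : o ≠ 0) (hzc : zc w = zc z)
    (hj : w j = 0) (hjm : ∀ a, w a = 0 → j ≤ a) (hp : z p = 0) (hpm : ∀ a, z a = 0 → p ≤ a)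
    (h : TS w z q) :
    ple (Function.update w j o) (Function.update z p o) := by
  have hz' : zc (Function.update w j o) = zc (Function.update z p o) := by
    have h1 := zc_up hj ho0
    have h2 := zc_up hp ho0
    omega
  obtain ⟨hq, h⟩ := h
  have hj' : (w j : ℕ) = 0 := by simp [hj]
  have hp' : (z p : ℕ) = 0 := by simp [hp]
  have hwq : (w q : ℕ) < z q := by
    have := (h q hq).1
    simpa using this
  have hqp : q ≠ p := by rintro rfl; omega
  by_cases ht : 2 ≤ (z q : ℕ)
  · right
    refine plt_of_TW q hz' ⟨?_, ?_⟩
    · rw [Function.update_of_ne hqp]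
      by_cases e : q = j
      · subst e; simp; intro e; omega
      · simpa [e] using hq
    · intro a ha
      rw [Function.update_of_ne hqp]
      by_cases e : a = j
      · subst e; left; simp; omega
      · rw [Function.update_of_ne e] at ha ⊢
        by_cases e2 : w a = z a
        · by_cases e3 : a = p
          · subst e3; left; rw [e2]; omega
          · simp [e3, e2] at ha
        · exact (h a e2).1
  · have ht1 : (z q : ℕ) = 1 := by omega
    have hw0 : w q = 0 := by apply Fin.ext; simp; omega
    have hjq := hjm q hw0
    by_cases hpq : q < p
    · right
      have hjp : p ≠ j := by rintro rfl; exact absurd hjq (not_le.2 hpq)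
      have hwp : (w p : ℕ) = 0 := by
        by_cases e : w p = z p
        · rw [e]; omega
        · have := (h p e).1
          rcases this with h1 | h1
          · omega
          · exact absurd h1.2 (not_lt.2 hpq.le)
      refine plt_of_TW p hz' ⟨?_, ?_⟩
      · simp only [Function.update_self, Function.update_of_ne hjp]
        intro e; rw [e] at hwp; omega
      · intro a ha
        rw [Function.update_self]
        by_cases e : a = j
        · subst e; right; simp; exact lt_of_le_of_lt hjq hpq
        · rw [Function.update_of_ne e] at ha ⊢
          by_cases e2 : w a = z a
          · by_cases e3 : a = p
            · subst e3; left; omega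
            · simp [e3, e2] at ha
          · rcases (h a e2).1 with h1 | h1
            · left; omega
            · right; exact ⟨by omega, h1.2.trans hpq⟩
    · have hpq' : p < q := lt_of_le_of_ne (not_lt.1 hpq) (Ne.symm hqp)
      by_cases hjq' : j = q
      · subst hjq'
        left
        have hsub : rset (Function.update w j o) 0 ⊆ rset (Function.update z p o) 0 := by
          intro a ha
          have ha : Function.update w j o a = 0 := by simpa [rset] using ha
          have haj : a ≠ j := by rintro rfl; simp at ha; exact ho0 ha
          rw [Function.update_of_ne haj] at ha
          have hja := lt_of_le_of_ne (hjm a ha) (Ne.symm haj)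
          have hap : a ≠ p := by rintro rfl; exact absurd hja (not_lt.2 hpq'.le)
          have : z a = 0 := by
            by_cases e : w a = z a
            · rw [← e, ha]
            · rcases (h a e).2 with h1 | h1
              · apply Fin.ext; simp; omega
              · exact absurd h1.2 (not_le.2 hja)
          simp [rset, hap, this]
        have heq := Finset.eq_of_subset_of_card_le hsub (le_of_eq hz'.symm)
        have hz0 : ∀ a, Function.update w j o a = 0 ↔ Function.update z p o a = 0 := by
          intro a
          have := congrArg (fun s => a ∈ s) heq
          simpa [rset] using this
        funext a
        by_cases e : a = j
        · subst e
          rw [Function.update_of_ne hqp, Function.update_self]; apply Fin.ext; omega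
        · have := hz0 a
          by_cases e2 : a = p
          · subst e2
            simp only [Function.update_self, Function.update_of_ne e] at this ⊢
            have hw : w a ≠ 0 := fun hh => ho0 (this.1 hh)
            have hw' : (w a : ℕ) ≠ 0 := fun e => hw (Fin.ext e)
            have := (h a (by rw [hp]; exact hw)).1
            apply Fin.ext; omega
          · simp only [Function.update_of_ne e, Function.update_of_ne e2] at this ⊢
            by_contra hne
            have h1 := h a hne
            have h3 : (w a : ℕ) = 0 ↔ (z a : ℕ) = 0 := by
              rw [← Fin.val_eq_zero_iff, ← Fin.val_eq_zero_iff] at this; exact this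
            have h4 : (w a : ℕ) ≠ z a := fun e => hne (Fin.ext e)
            omega
      · right
        have hjlt := lt_of_le_of_ne hjq hjq'
        refine plt_of_TW q hz' ⟨?_, ?_⟩
        · rw [Function.update_of_ne hqp, Function.update_of_ne (Ne.symm hjq')]; exact hq
        · intro a ha
          rw [Function.update_of_ne hqp]
          by_cases e : a = j
          · subst e; right; simp; exact ⟨by omega, hjlt⟩
          · rw [Function.update_of_ne e] at ha ⊢
            by_cases e2 : w a = z a
            · by_cases e3 : a = p
              · subst e3; left; rw [e2]; omega
              · simp [e3, e2] at ha
            · exact (h a e2).1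

lemma update_cover {k N : ℕ} {w : Fin N → Fin (k + 1)} {j : Fin N} {o : Fin (k+1)} (hj : w j = 0) :
    Function.update (Function.update w j o) j 0 = w := by
  rw [Function.update_idem, ← hj, Function.update_eq_self]

lemma dS_init {k N : ℕ} {B : Finset (Fin N → Fin (k + 1))} (hB : isInitSeg B) :
    isInitSeg (dShadow B) := by
  intro z hz w hw
  rcases hw with rfl | hw
  · exact hz
  obtain ⟨y, hy, i, hi, rfl⟩ := mem_dS.1 hz
  obtain ⟨o, ho, ho0⟩ := exists_one hi
  have hzz := zc_up0 hi
  have hwz := plt_zc hw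
  obtain ⟨j, hj, hjm⟩ := exists_first_zero (x := w) (by omega)
  refine mem_dS.2 ⟨Function.update w j o, ?_, j, by simpa using ho0, update_cover hj⟩
  rcases (plt_iff_TS _ _).1 hw with h | ⟨h, q, hq⟩
  · apply hB y hy
    right
    apply plt_of_zc
    have := zc_up hj ho0
    omega
  · obtain ⟨p, hp, hpm⟩ := exists_first_zero (x := Function.update y i 0) (by omega)
    have h1 := mincover_le hi ho ho0 hp hpm
    have h2 := mincover_mono ho ho0 h hj hjm hp hpm hq
    exact hB _ (hB y hy _ h1) _ h2

/-! ### compression -/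

noncomputable def sl {k n : ℕ} (s : Fin (n + 1)) (A : Finset (Fin (n + 1) → Fin (k + 1))) (t : Fin (k + 1)) :
    Finset (Fin n → Fin (k + 1)) :=
  Finset.univ.filter fun y => (s.insertNth t y : Fin (n + 1) → Fin (k + 1)) ∈ A

lemma mem_sl {k n : ℕ} {s : Fin (n + 1)} {A : Finset (Fin (n + 1) → Fin (k + 1))} {t : Fin (k + 1)}
    {y : Fin n → Fin (k + 1)} : y ∈ sl s A t ↔ (s.insertNth t y : Fin (n + 1) → Fin (k + 1)) ∈ A := by
  simp [sl]

lemma sum_sl {k n : ℕ} (s : Fin (n + 1)) (A : Finset (Fin (n + 1) → Fin (k + 1)))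
    (g : (Fin (n + 1) → Fin (k + 1)) → ℕ) :
    ∑ x ∈ A, g x = ∑ t, ∑ y ∈ sl s A t, g (s.insertNth t y) := by
  have h1 : ∑ x ∈ A, g x = ∑ x, if x ∈ A then g x else 0 := by
    rw [Finset.sum_ite_mem, Finset.univ_inter]
  rw [h1, ← (Fin.insertNthEquiv (fun _ => Fin (k+1)) s).sum_comp, Fintype.sum_prod_type]
  refine Finset.sum_congr rfl fun t _ => ?_
  rw [sl, Finset.sum_filter]
  rfl

lemma card_sl {k n : ℕ} (s : Fin (n + 1)) (A : Finset (Fin (n + 1) → Fin (k + 1))) :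
    A.card = ∑ t, (sl s A t).card := by
  have := sum_sl s A (fun _ => 1)
  simpa using this

lemma zc_ins {k n : ℕ} (s : Fin (n + 1)) (t : Fin (k + 1)) (y : Fin n → Fin (k + 1)) :
    zc (s.insertNth t y : Fin (n + 1) → Fin (k + 1)) = (if (t : ℕ) = 0 then 1 else 0) + zc y := by
  unfold zc rset
  rw [Finset.card_filter, Finset.card_filter, Fin.sum_univ_succAbove _ s]
  simp

lemma plt_ins {k n : ℕ} (s : Fin (n + 1)) (t : Fin (k + 1)) {y z : Fin n → Fin (k + 1)} (h : plt y z) :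
    plt (s.insertNth t y : Fin (n + 1) → Fin (k + 1)) (s.insertNth t z) := by
  rcases (plt_iff_TS _ _).1 h with h | ⟨h, q, hq⟩
  · apply plt_of_zc; rw [zc_ins, zc_ins]; omega
  · refine plt_of_TW (s.succAbove q) (by rw [zc_ins, zc_ins, h]) ⟨by simpa using hq.1, ?_⟩
    intro j
    refine Fin.succAboveCases s ?_ (fun j => ?_) j
    · simp
    · intro hj
      simp only [Fin.insertNth_apply_succAbove] at hj ⊢
      have := (hq.2 j hj).1
      rw [(Fin.strictMono_succAbove s).lt_iff_lt]
      exact this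

lemma upd_ins {k n : ℕ} (s : Fin (n + 1)) (t c : Fin (k + 1)) (y : Fin n → Fin (k + 1)) (j : Fin n) :
    Function.update (s.insertNth t y : Fin (n + 1) → Fin (k + 1)) (s.succAbove j) c =
      s.insertNth t (Function.update y j c) := by
  funext a
  refine Fin.succAboveCases s ?_ (fun a => ?_) a
  · simp [Fin.ne_succAbove]
  · by_cases h : a = j
    · subst h; simp
    · have : s.succAbove a ≠ s.succAbove j := fun e => h (Fin.succAbove_right_injective e)
      simp [h, this]

lemma upd_ins_self {k n : ℕ} (s : Fin (n + 1)) (t c : Fin (k + 1)) (y : Fin n → Fin (k + 1)) :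
    Function.update (s.insertNth t y : Fin (n + 1) → Fin (k + 1)) s c = s.insertNth c y := by
  funext a
  refine Fin.succAboveCases s ?_ (fun a => ?_) a
  · simp
  · simp [Fin.succAbove_ne]

lemma sl_d_sup {k n : ℕ} (s : Fin (n + 1)) (A : Finset (Fin (n + 1) → Fin (k + 1))) (t : Fin (k + 1)) :
    dShadow (sl s A t) ⊆ sl s (dShadow A) t := by
  intro u hu
  obtain ⟨y, hy, j, hj, rfl⟩ := mem_dS.1 hu
  rw [mem_sl] at hy ⊢
  exact mem_dS.2 ⟨_, hy, s.succAbove j, by simpa using hj, upd_ins _ _ _ _ _⟩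

lemma sl_d_sup0 {k n : ℕ} (s : Fin (n + 1)) (A : Finset (Fin (n + 1) → Fin (k + 1))) (t : Fin (k + 1))
    (ht : t ≠ 0) : sl s A t ⊆ sl s (dShadow A) 0 := by
  intro y hy
  rw [mem_sl] at hy ⊢
  exact mem_dS.2 ⟨_, hy, s, by simpa using ht, upd_ins_self _ _ _ _⟩

lemma sl_d_sub {k n : ℕ} (s : Fin (n + 1)) (A : Finset (Fin (n + 1) → Fin (k + 1))) (t : Fin (k + 1))
    (y : Fin n → Fin (k + 1)) (hy : y ∈ sl s (dShadow A) t) :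
    y ∈ dShadow (sl s A t) ∨ (t = 0 ∧ ∃ c, c ≠ 0 ∧ y ∈ sl s A c) := by
  rw [mem_sl] at hy
  obtain ⟨a, ha, j, hj, e⟩ := mem_dS.1 hy
  obtain ⟨c, b, rfl⟩ : ∃ c b, a = (s.insertNth c b : Fin (n + 1) → Fin (k + 1)) :=
    ⟨a s, s.removeNth a, by simp⟩
  revert hj e
  refine Fin.succAboveCases s ?_ (fun j => ?_) j
  · intro hj e
    right
    rw [upd_ins_self] at e
    have h0 := congrFun e s
    have h1 := congrArg s.removeNth e
    simp at h0 h1 hj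
    subst h1
    exact ⟨h0.symm, c, hj, mem_sl.2 ha⟩
  · intro hj e
    left
    rw [upd_ins] at e
    have h0 := congrFun e s
    have h1 := congrArg s.removeNth e
    simp at h0 h1 hj
    subst h0
    exact mem_dS.2 ⟨b, mem_sl.2 ha, j, hj, h1⟩

def Closed {k N : ℕ} (A : Finset (Fin N → Fin (k + 1))) : Prop :=
  ∀ y ∈ A, ∀ z, plt z y → (∃ j, z j = y j) → z ∈ A

def Good (k N : ℕ) : Prop := ∀ A : Finset (Fin N → Fin (k + 1)), ∃ B : Finset (Fin N → Fin (k + 1)), isInitSeg B ∧ B.card = A.card ∧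
  (dShadow B).card ≤ (dShadow A).card

lemma compress_step {k n : ℕ} (hg : Good k n) (A : Finset (Fin (n + 1) → Fin (k + 1)))
    (hA : ¬ Closed A) : ∃ A' : Finset (Fin (n + 1) → Fin (k + 1)), A'.card = A.card ∧
      (dShadow A').card ≤ (dShadow A).card ∧ ∑ x ∈ A', wt x < ∑ x ∈ A, wt x := by
  unfold Closed at hA
  push Not at hA
  obtain ⟨y, hy, z, hzy, ⟨s, hs⟩, hzA⟩ := hA
  choose B hB1 hB2 hB3 using fun t => hg (sl s A t)
  let A' : Finset (Fin (n + 1) → Fin (k + 1)) := univ.filter fun x => s.removeNth x ∈ B (x s)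
  have hsl : ∀ t, sl s A' t = B t := by
    intro t; ext u; rw [mem_sl]; simp [A']
  refine ⟨A', ?_, ?_, ?_⟩
  · rw [card_sl s, card_sl s A]
    exact Finset.sum_congr rfl fun t _ => by rw [hsl, hB2]
  · rw [card_sl s, card_sl s (dShadow A)]
    refine Finset.sum_le_sum fun t _ => ?_
    by_cases ht : t = 0
    · subst ht
      have hsub : sl s (dShadow A') 0 ⊆ (univ : Finset (Fin (k+1))).biUnion
          fun c => if c = 0 then dShadow (B 0) else B c := by
        intro u hu
        rw [mem_biUnion]
        rcases sl_d_sub s A' 0 u hu with h | ⟨-, c, hc, h⟩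
        · exact ⟨0, mem_univ _, by rw [hsl] at h; simpa using h⟩
        · exact ⟨c, mem_univ _, by rw [hsl] at h; simpa [hc] using h⟩
      refine (Finset.card_le_card hsub).trans (union_init _ _ ?_ _ ?_)
      · intro c _
        by_cases hc : c = 0
        · simp only [hc, if_true]; exact dS_init (hB1 _)
        · simp only [hc, if_false]; exact hB1 _
      · intro c _
        by_cases hc : c = 0
        · simp only [hc, if_true]; exact (hB3 0).trans (Finset.card_le_card (sl_d_sup s A 0))
        · simp only [hc, if_false, hB2]; exact Finset.card_le_card (sl_d_sup0 s A c hc)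
    · refine le_trans (Finset.card_le_card (t := dShadow (B t)) ?_)
        ((hB3 t).trans (Finset.card_le_card (sl_d_sup s A t)))
      intro u hu
      rcases sl_d_sub s A' t u hu with h | ⟨h, -⟩
      · rwa [hsl] at h
      · exact absurd h ht
  · rw [sum_sl s, sum_sl s A]
    have hlt : ∀ t, B t ≠ sl s A t → ∑ y ∈ B t, wt (s.insertNth t y : Fin (n + 1) → Fin (k + 1)) <
        ∑ y ∈ sl s A t, wt (s.insertNth t y : Fin (n + 1) → Fin (k + 1)) := by
      intro t ht
      exact wsum _ _ _ (hB2 t) (fun b hb _ a _ ha => wt_lt (plt_ins s t (initseg_sep (hB1 t) hb ha))) ht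
    refine Finset.sum_lt_sum (fun t _ => ?_) ⟨y s, mem_univ _, ?_⟩
    · rw [hsl]
      by_cases ht : B t = sl s A t
      · rw [ht]
      · exact (hlt t ht).le
    · rw [hsl]
      apply hlt
      intro e
      have h1 : s.removeNth y ∈ B (y s) := by rw [e, mem_sl]; simpa using hy
      have h2 : s.removeNth z ∉ B (y s) := by rw [e, mem_sl, ← hs]; simpa using hzA
      have h3 := plt_ins s (y s) (initseg_sep (hB1 _) h1 h2)
      nth_rewrite 2 [← hs] at h3
      simp at h3
      exact plt_irrefl _ (plt_trans h3 hzy)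

end ShadowAux

namespace ShadowAux

/-- positions giving new shadow elements -/
noncomputable def Fs {k N : ℕ} (x : Fin N → Fin (k + 1)) : Finset (Fin N) :=
  univ.filter fun i => (x i : ℕ) = 1 ∧ ∀ j, x j = 0 → i < j

lemma mem_Fs {k N : ℕ} {x : Fin N → Fin (k + 1)} {i : Fin N} :
    i ∈ Fs x ↔ (x i : ℕ) = 1 ∧ ∀ j, x j = 0 → i < j := by simp [Fs]

lemma ne_zero_of_val {k : ℕ} {v : Fin (k+1)} (h : (v : ℕ) ≠ 0) : v ≠ 0 := by
  rintro rfl; simp at h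

lemma val_ne_zero' {k : ℕ} {v : Fin (k+1)} (h : v ≠ 0) : (v : ℕ) ≠ 0 := fun e => h (Fin.ext e)

/-- a cover of a shadow -/
lemma cover_eq {k N : ℕ} {x a : Fin N → Fin (k + 1)} {i j : Fin N}
    (h : Function.update a j 0 = Function.update x i 0) (hij : j ≠ i) :
    x j = 0 ∧ a i = 0 ∧ ∀ b, b ≠ i → b ≠ j → a b = x b := by
  refine ⟨?_, ?_, fun b hb hb' => ?_⟩
  · have := congrFun h j; simpa [hij] using this.symm
  · have := congrFun h i; simpa [Ne.symm hij] using this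
  · have := congrFun h b; simpa [hb, hb'] using this

lemma cover_eq' {k N : ℕ} {x a : Fin N → Fin (k + 1)} {i : Fin N}
    (h : Function.update a i 0 = Function.update x i 0) : a = Function.update x i (a i) := by
  funext b
  by_cases hb : b = i
  · subst hb; simp
  · have := congrFun h b; simpa [hb] using this

lemma F1 {k N : ℕ} {x a : Fin N → Fin (k + 1)} {i j : Fin N} (hi : i ∈ Fs x) (hj : a j ≠ 0)
    (h : Function.update a j 0 = Function.update x i 0) : a = x ∨ plt x a := by
  rw [mem_Fs] at hi
  have hx0 : x i ≠ 0 := ne_zero_of_val (by omega)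
  have hj' := val_ne_zero' hj
  by_cases hij : j = i
  · subst hij
    have e := cover_eq' h
    by_cases e2 : a j = x j
    · left; rw [e, e2]; simp
    · right; rw [e]
      apply plt_up _ hx0
      have : (a j : ℕ) ≠ x j := fun e => e2 (Fin.ext e)
      omega
  · right
    obtain ⟨h1, h2, h3⟩ := cover_eq h hij
    have hlt := hi.2 j h1
    refine plt_of_TW j ?_ ⟨by rw [h1]; exact Ne.symm hj, ?_⟩
    · have e1 := zc_up0 hj
      have e2 := zc_up0 hx0
      rw [h] at e1; omega
    · intro b hb
      by_cases hbi : b = i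
      · subst hbi
        have : (a j : ℕ) = 1 ∨ 1 < (a j : ℕ) := by omega
        rcases this with h | h
        · right; exact ⟨by omega, hlt⟩
        · left; omega
      · by_cases hbj : b = j
        · subst hbj; left; rw [h1]; simp only [Fin.val_zero]; omega
        · exact absurd (h3 b hbi hbj).symm hb

lemma F2 {k N : ℕ} {x : Fin N → Fin (k + 1)} {i : Fin N} (hx : x i ≠ 0) (hi : i ∉ Fs x) :
    ∃ a, plt a x ∧ ∃ j, a j ≠ 0 ∧ Function.update a j 0 = Function.update x i 0 := by
  obtain ⟨o, ho, ho0⟩ := exists_one hx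
  have hx' := val_ne_zero' hx
  by_cases h1 : (x i : ℕ) = 1
  · rw [mem_Fs] at hi
    push Not at hi
    obtain ⟨j, hj, hji⟩ := hi h1
    have hne : j ≠ i := by rintro rfl; exact hx hj
    have hlt := lt_of_le_of_ne hji hne
    refine ⟨Function.update (Function.update x i 0) j o, ?_, j, by simpa using ho0,
      update_cover (by simp [hne, hj])⟩
    refine plt_of_TW i (zc_swap hx hj ho0) ⟨?_, ?_⟩
    · simp [Ne.symm hne, Ne.symm hx]
    · intro b hb
      by_cases hbj : b = j
      · subst hbj; right; simp only [Function.update_self]; exact ⟨by omega, hlt⟩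
      · by_cases hbi : b = i
        · subst hbi; left; rw [Function.update_of_ne hbj, Function.update_self]; simp only [Fin.val_zero]; omega
        · simp [hbi, hbj] at hb
  · exact ⟨Function.update x i o, plt_down (by omega) ho0, i, by simpa using ho0, by simp⟩

section exch
variable {k N : ℕ} {A : Finset (Fin N → Fin (k + 1))} {x y : Fin N → Fin (k + 1)}

lemma exch_wt (hx : x ∉ A) (hy : y ∈ A) (hxy : plt x y) :
    (insert x (A.erase y)).card = A.card ∧ ∑ z ∈ insert x (A.erase y), wt z < ∑ z ∈ A, wt z := by
  have hx' : x ∉ A.erase y := fun h => hx (mem_of_mem_erase h)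
  constructor
  · rw [card_insert_of_notMem hx', card_erase_of_mem hy]
    have := Finset.card_pos.2 ⟨y, hy⟩
    omega
  · rw [sum_insert hx', ← Finset.add_sum_erase A wt hy]
    have := wt_lt hxy
    omega

lemma exch_sub (hxy : plt x y) (hmin : ∀ a, plt a x → a ∈ A) :
    dShadow (insert x (A.erase y)) ⊆ dShadow A ∪ (Fs x).image fun i => Function.update x i 0 := by
  intro u hu
  obtain ⟨a, ha, j, hj, rfl⟩ := mem_dS.1 hu
  rw [mem_union]
  rcases mem_insert.1 ha with rfl | ha
  · by_cases hF : j ∈ Fs a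
    · right; exact mem_image_of_mem _ hF
    · left
      obtain ⟨b, hb, l, hl, e⟩ := F2 hj hF
      exact mem_dS.2 ⟨b, hmin b hb, l, hl, e⟩
  · left; exact mem_dS.2 ⟨a, mem_of_mem_erase ha, j, hj, rfl⟩

lemma exch_disj (hxy : plt x y) (hmax : ∀ a ∈ A, a = y ∨ plt a y) {i : Fin N} (hi : i ∈ Fs y) :
    Function.update y i 0 ∉ dShadow (insert x (A.erase y)) := by
  intro hu
  obtain ⟨a, ha, j, hj, e⟩ := mem_dS.1 hu
  have hay : plt a y := by
    rcases mem_insert.1 ha with rfl | ha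
    · exact hxy
    · exact (hmax a (mem_of_mem_erase ha)).resolve_left (ne_of_mem_erase ha)
  rcases F1 hi hj e with rfl | h
  · exact plt_irrefl _ hay
  · exact plt_irrefl _ (plt_trans h hay)

lemma exch_card (hy : y ∈ A) (hxy : plt x y) (hmin : ∀ a, plt a x → a ∈ A)
    (hmax : ∀ a ∈ A, a = y ∨ plt a y) (hF : (Fs x).card ≤ (Fs y).card) :
    (dShadow (insert x (A.erase y))).card ≤ (dShadow A).card := by
  have hy0 : ∀ i ∈ Fs y, y i ≠ 0 := fun i hi => ne_zero_of_val (by rw [(mem_Fs.1 hi).1]; omega)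
  set L := (Fs y).image fun i => Function.update y i 0 with hL
  set G := (Fs x).image fun i => Function.update x i 0 with hG
  have hLc : L.card = (Fs y).card := by
    apply Finset.card_image_of_injOn
    intro i hi j hj e
    by_contra hne
    have := congrFun e i
    simp [hne] at this
    exact hy0 i hi this.symm
  have hLs : L ⊆ dShadow A := by
    intro u hu
    obtain ⟨i, hi, rfl⟩ := mem_image.1 hu
    exact mem_dS.2 ⟨y, hy, i, hy0 i hi, rfl⟩
  have hsub : dShadow (insert x (A.erase y)) ⊆ (dShadow A \ L) ∪ G := by
    intro u hu
    rcases mem_union.1 (exch_sub hxy hmin hu) with h | h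
    · refine mem_union_left _ (mem_sdiff.2 ⟨h, fun hl => ?_⟩)
      obtain ⟨i, hi, rfl⟩ := mem_image.1 hl
      exact exch_disj hxy hmax hi hu
    · exact mem_union_right _ h
  have h1 := Finset.card_le_card hsub
  have h2 := Finset.card_union_le (dShadow A \ L) G
  have h3 := Finset.card_sdiff_add_card_eq_card hLs
  have h4 : G.card ≤ (Fs x).card := Finset.card_image_le
  omega

/-- case: x has a zero, N at least 3 -/
lemma no_bad (hN : 3 ≤ N) (hxy : plt x y) (hd : ∀ j, x j ≠ y j)
    (hz : ∀ z, plt x z → plt z y → (∃ j, z j = x j) → (∃ j, z j = y j) → False)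
    (h0 : zc x ≠ 0) : (Fs x).card ≤ (Fs y).card := by
  by_contra hF
  push Not at hF
  obtain ⟨i, hi⟩ := Finset.card_pos.1 (lt_of_le_of_lt (Nat.zero_le _) hF)
  obtain ⟨p, hp⟩ := exists_zero h0
  have hi' := mem_Fs.1 hi
  have hx0 : x i ≠ 0 := ne_zero_of_val (by omega)
  have hip := hi'.2 p hp
  have hyp : y p ≠ 0 := fun e => hd p (by rw [hp, e])
  have hyp' := val_ne_zero' hyp
  have third : ∀ a b : Fin N, ∃ c, c ≠ a ∧ c ≠ b := by
    intro a b
    by_contra hcon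
    push Not at hcon
    have : (univ : Finset (Fin N)) ⊆ {a, b} := by
      intro c _
      by_cases h : c = a
      · simp [h]
      · simp [hcon c h]
    have := Finset.card_le_card this
    have h2 : ({a, b} : Finset (Fin N)).card ≤ 2 := Finset.card_le_two
    simp at this; omega
  -- general facts
  have hzz : zc x = zc y ∧ ∃ q, TS x y q := by
    rcases (plt_iff_TS _ _).1 hxy with h | h
    · exfalso
      set z := Function.update (Function.update x i 0) p (y p) with hzdef
      have hzc : zc z = zc x := zc_swap hx0 hp hyp
      obtain ⟨c, hc1, hc2⟩ := third i p
      refine hz z (plt_of_TW p hzc.symm ⟨?_, ?_⟩) (plt_of_zc (by omega)) ⟨c, ?_⟩ ⟨p, ?_⟩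
      · simpa [hzdef] using hd p
      · intro b hb
        rw [hzdef] at hb ⊢
        rw [Function.update_self]
        by_cases hbp : b = p
        · subst hbp; left; rw [hp]; simp only [Fin.val_zero]; omega
        · by_cases hbi : b = i
          · subst hbi
            have : (y p : ℕ) = 1 ∨ 1 < (y p : ℕ) := by omega
            rcases this with h | h
            · right; exact ⟨by omega, hip⟩
            · left; omega
          · simp [hbp, hbi] at hb
      · simp [hzdef, hc1, hc2]
      · simp [hzdef]
    · exact h
  obtain ⟨hzxy, q, hq, hT⟩ := hzz
  -- the top position is p
  have hqp : q = p := by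
    by_contra hqp
    set z := Function.update (Function.update x i 0) p (y p) with hzdef
    have hzc : zc z = zc x := zc_swap hx0 hp hyp
    obtain ⟨c, hc1, hc2⟩ := third i p
    have hxq := (hT q hq).1
    have hii := (hT i (hd i)).1
    refine hz z (plt_of_TW p hzc.symm ⟨?_, ?_⟩)
      (plt_of_TW q (hzc.trans hzxy) ⟨?_, ?_⟩) ⟨c, ?_⟩ ⟨p, ?_⟩
    · simpa [hzdef] using hd p
    · intro b hb
      rw [hzdef] at hb ⊢
      rw [Function.update_self]
      by_cases hbp : b = p
      · subst hbp; left; rw [hp]; simp only [Fin.val_zero]; omega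
      · by_cases hbi : b = i
        · subst hbi
          have : (y p : ℕ) = 1 ∨ 1 < (y p : ℕ) := by omega
          rcases this with h | h
          · right; exact ⟨by omega, hip⟩
          · left; omega
        · simp [hbp, hbi] at hb
    · rw [hzdef, Function.update_of_ne hqp]
      by_cases hqi : q = i
      · subst hqi; rw [Function.update_self]; intro e; rw [← e] at hii; simp at hii
      · rw [Function.update_of_ne hqi]; exact hq
    · intro b hb
      by_cases hbp : b = p
      · subst hbp; simp [hzdef] at hb
      · by_cases hbi : b = i
        · subst hbi; left; rw [hzdef, Function.update_of_ne hbp, Function.update_self]; simp only [Fin.val_zero]; omega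
        · rw [hzdef, Function.update_of_ne hbp, Function.update_of_ne hbi]; exact (hT b (hd b)).1
    · simp [hzdef, hc1, hc2]
    · simp [hzdef]
  subst hqp
  have hT1 : ∀ j, (x j : ℕ) < y q ∨ ((x j : ℕ) = y q ∧ j < q) := fun j => (hT j (hd j)).1
  have hT2 : ∀ j, (y j : ℕ) < y q ∨ ((y j : ℕ) = y q ∧ j ≤ q) := fun j => (hT j (hd j)).2
  -- any z with same zero count and z q = y q is above x
  have above : ∀ z : Fin N → Fin (k+1), zc z = zc y → z q = y q → plt x z := by
    intro z h1 h2
    refine plt_of_TW q (by omega) ⟨by rw [h2]; exact hq, fun j _ => by rw [h2]; exact hT1 j⟩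
  by_cases ht : (y q : ℕ) = 1
  · -- binary case
    have hone : zc x ≤ 1 := by
      apply zc_one (p := q)
      intro j hj
      have hy : (y j : ℕ) ≠ 0 := fun e => hd j (by rw [hj]; exact (Fin.ext e).symm)
      have h1 : j ≤ q := by rcases hT2 j with h | h; omega; exact h.2
      have hij := hi'.2 j hj
      by_contra hne
      have hjq : j < q := lt_of_le_of_ne h1 hne
      -- use j in place of q
      obtain ⟨c, hc1, hc2⟩ := third i j
      have hy1 : (y j : ℕ) = 1 := by rcases hT2 j with h | h <;> omega
      set z := Function.update (Function.update x i 0) j (y j) with hzdef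
      have hyj : y j ≠ 0 := ne_zero_of_val hy
      have hzc : zc z = zc x := zc_swap hx0 hj hyj
      refine hz z (plt_of_TW j hzc.symm ⟨by simpa [hzdef] using hd j, ?_⟩)
        (plt_of_TW q (hzc.trans hzxy) ⟨?_, ?_⟩) ⟨c, by simp [hzdef, hc1, hc2]⟩ ⟨j, by simp [hzdef]⟩
      · intro b hb
        rw [hzdef] at hb ⊢
        rw [Function.update_self]
        by_cases hbp : b = j
        · subst hbp; left; rw [hj]; simp only [Fin.val_zero]; omega
        · by_cases hbi : b = i
          · subst hbi; right; exact ⟨by omega, hij⟩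
          · simp [hbp, hbi] at hb
      · have e1 : q ≠ j := Ne.symm hne
        have e2 : q ≠ i := by rintro rfl; exact absurd hip (lt_irrefl _)
        rw [hzdef, Function.update_of_ne e1, Function.update_of_ne e2]; exact hq
      · intro b hb
        by_cases hbp : b = j
        · subst hbp; simp [hzdef] at hb
        · by_cases hbi : b = i
          · subst hbi; left; rw [hzdef, Function.update_of_ne hbp, Function.update_self]; simp only [Fin.val_zero]; omega
          · rw [hzdef, Function.update_of_ne hbp, Function.update_of_ne hbi]; exact hT1 b
    obtain ⟨c, hc1, hc2⟩ := third i q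
    have hy0 : ∀ j, j ≠ q → y j = 0 := by
      intro j hj
      have hxj : x j ≠ 0 := fun e => hj (zc_le_one hone e hp)
      have hxj' := val_ne_zero' hxj
      have hne : (x j : ℕ) ≠ y j := fun e => hd j (Fin.ext e)
      apply Fin.ext
      simp only [Fin.val_zero]
      have := hT1 j
      have := hT2 j
      omega
    have hiq : i ≠ q := by rintro rfl; exact absurd hip (lt_irrefl _)
    exact hc1 (zc_le_one (hzxy ▸ hone) (hy0 c hc2) (hy0 i hiq))
  · have ht2 : 2 ≤ (y q : ℕ) := by omega
    obtain ⟨o, ho, ho0⟩ := exists_one hyp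
    -- zero of y at every element of Fs x
    have hyF : ∀ a ∈ Fs x, y a = 0 := by
      intro a ha
      have ha' := mem_Fs.1 ha
      have haq : a ≠ q := by rintro rfl; exact absurd (ha'.2 a hp) (lt_irrefl _)
      by_contra hya
      have hya' := val_ne_zero' hya
      have hne : (x a : ℕ) ≠ y a := fun e => hd a (Fin.ext e)
      refine hz (Function.update y a o) (above _ (zc_upne hya ho0) (by simp [Ne.symm haq]))
        (plt_down (by omega) ho0) ⟨a, ?_⟩ ⟨q, by simp [Ne.symm haq]⟩
      rw [Function.update_self]; apply Fin.ext; omega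
    have hyi := hyF i hi
    have hiq : i ≠ q := by rintro rfl; exact absurd hip (lt_irrefl _)
    have hyj : ∀ j, j ≠ q → y j ≠ 0 → (y j : ℕ) = 1 ∧ j < i := by
      intro j hjq hj
      have hj' := val_ne_zero' hj
      by_contra hcon
      have hji : j ≠ i := by rintro rfl; exact hj hyi
      have hcmp : 1 < (y j : ℕ) ∨ (1 = (y j : ℕ) ∧ i < j) := by
        by_cases e : (y j : ℕ) = 1
        · right; refine ⟨e.symm, lt_of_le_of_ne (not_lt.1 fun h => hcon ⟨e, h⟩) (Ne.symm hji)⟩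
        · left; omega
      have hzc := zc_swap hj hyi ho0
      refine hz (Function.update (Function.update y j 0) i o)
        (above _ hzc (by simp [Ne.symm hiq, Ne.symm hjq]))
        (plt_of_TW j hzc ⟨?_, ?_⟩) ⟨i, ?_⟩ ⟨q, by simp [Ne.symm hiq, Ne.symm hjq]⟩
      · rw [Function.update_of_ne hji, Function.update_self]; exact Ne.symm hj
      · intro b hb
        by_cases hbi : b = i
        · subst hbi; rw [Function.update_self, ho]; exact hcmp
        · by_cases hbj : b = j
          · subst hbj; left; rw [Function.update_of_ne hbi, Function.update_self]; simp only [Fin.val_zero]; omega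
          · simp [hbi, hbj] at hb
      · rw [Function.update_self]; apply Fin.ext; omega
    have hone : zc x ≤ 1 := by
      apply zc_one (p := q)
      intro j hj
      by_contra hne
      have h1 := hyj j hne (fun e => hd j (by rw [hj, e]))
      exact absurd (hi'.2 j hj) (not_lt.2 h1.2.le)
    have hone' : zc y ≤ 1 := hzxy ▸ hone
    obtain ⟨c, hc1, hc2⟩ := third i q
    have hyc : y c ≠ 0 := fun e => hc1 (zc_le_one hone' e hyi)
    have hcF : c ∈ Fs y := by
      rw [mem_Fs]
      refine ⟨(hyj c hc2 hyc).1, fun j hj => ?_⟩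
      rw [zc_le_one hone' hj hyi]
      exact (hyj c hc2 hyc).2
    have h1 : 1 ≤ (Fs y).card := Finset.card_pos.2 ⟨c, hcF⟩
    have h2 : (Fs x).card ≤ 1 := Finset.card_le_one.2 fun a ha b hb =>
      zc_le_one hone' (hyF a ha) (hyF b hb)
    omega

end exch

end ShadowAux

namespace ShadowAux

section top
variable {k N : ℕ} {A : Finset (Fin N → Fin (k + 1))} {x y : Fin N → Fin (k + 1)}

/-- a line through a point in direction i, values 1..m -/
noncomputable def line (x : Fin N → Fin (k + 1)) (i : Fin N) (m : ℕ) : Finset (Fin N → Fin (k + 1)) :=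
  (univ.filter fun v : Fin (k+1) => v ≠ 0 ∧ (v : ℕ) ≤ m).image fun v => Function.update x i v

lemma mem_line {i : Fin N} {m : ℕ} {a : Fin N → Fin (k + 1)} :
    a ∈ line x i m ↔ ∃ v : Fin (k+1), (v ≠ 0 ∧ (v : ℕ) ≤ m) ∧ Function.update x i v = a := by
  simp [line]

lemma card_line (i : Fin N) (m : ℕ) :
    (line x i m).card = (univ.filter fun v : Fin (k+1) => v ≠ 0 ∧ (v : ℕ) ≤ m).card :=
  Finset.card_image_of_injective _ (Function.update_injective x i)

lemma top_case (hN : 2 ≤ N) (hx : x ∉ A) (hy : y ∈ A) (hA : Closed A) (hxy : plt x y)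
    (hmax : ∀ a ∈ A, a = y ∨ plt a y) (hd : ∀ j, x j ≠ y j)
    (hz : ∀ z, plt x z → plt z y → (∃ j, z j = x j) → (∃ j, z j = y j) → False)
    (h0 : zc x = 0) (hF : (Fs y).card < (Fs x).card) :
    ∃ A' : Finset (Fin N → Fin (k + 1)), A'.card = A.card ∧
      (dShadow A').card ≤ (dShadow A).card ∧ ∑ x ∈ A', wt x < ∑ x ∈ A, wt x := by
  have hzy : zc y = 0 := by have := plt_zc hxy; omega
  have hxn : ∀ j, x j ≠ 0 := fun j e => by have := zc_pos e; omega
  have hyn : ∀ j, y j ≠ 0 := fun j e => by have := zc_pos e; omega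
  obtain ⟨q, hq, hT⟩ : ∃ q, TS x y q := by
    rcases (plt_iff_TS _ _).1 hxy with h | h
    · omega
    · exact h.2
  have hT1 : ∀ j, (x j : ℕ) < y q ∨ ((x j : ℕ) = y q ∧ j < q) := fun j => (hT j (hd j)).1
  obtain ⟨i, hiq⟩ : ∃ i, i ≠ q := by
    have : Nontrivial (Fin N) := Fin.nontrivial_iff_two_le.2 hN
    exact exists_ne q
  -- x is above y away from q
  have hgt : ∀ j, j ≠ q → (y j : ℕ) < x j := by
    intro j hj
    by_contra hcon
    have hne : (x j : ℕ) ≠ y j := fun e => hd j (Fin.ext e)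
    have e : zc (Function.update y j (x j)) = zc y := zc_upne (hyn j) (hxn j)
    refine hz (Function.update y j (x j)) (plt_of_TW q (by omega) ⟨?_, ?_⟩)
      (plt_down (by omega) (hxn j)) ⟨j, by simp⟩ ⟨q, by simp [Ne.symm hj]⟩
    · rw [Function.update_of_ne (Ne.symm hj)]; exact hq
    · intro b _
      rw [Function.update_of_ne (Ne.symm hj)]; exact hT1 b
  have hFx : Fs x ⊆ {q} := by
    intro a ha
    rw [mem_singleton]
    by_contra hne
    have h1 := hgt a hne
    have h2 := (mem_Fs.1 ha).1
    have h3 := val_ne_zero' (hyn a)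
    omega
  have hFc := Finset.card_le_card hFx
  rw [card_singleton] at hFc
  have hFy : Fs y = ∅ := Finset.card_eq_zero.1 (by omega)
  obtain ⟨q', hq'⟩ := Finset.card_pos.1 (lt_of_le_of_lt (Nat.zero_le _) hF)
  have hxq : (x q : ℕ) = 1 := by
    have := mem_singleton.1 (hFx hq')
    subst this
    exact (mem_Fs.1 hq').1
  have hy2 : ∀ j, 2 ≤ (y j : ℕ) := by
    intro j
    have h3 := val_ne_zero' (hyn j)
    by_contra hcon
    have : j ∈ Fs y := mem_Fs.2 ⟨by omega, fun a ha => absurd ha (hyn a)⟩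
    rw [hFy] at this
    simp at this
  obtain ⟨o, ho, ho0⟩ := exists_one (hyn q)
  set m := (y i : ℕ) with hm
  have hmt : m < y q := by
    have h1 := hgt i hiq
    have h2 := hT1 i
    omega
  -- facts on lines
  have hX : ∀ a ∈ line x q m, a ∉ A := by
    intro a ha haA
    obtain ⟨v, ⟨hv, hvm⟩, rfl⟩ := mem_line.1 ha
    have hv' := val_ne_zero' hv
    by_cases hv1 : (v : ℕ) = 1
    · have : v = x q := Fin.ext (by omega)
      rw [this, Function.update_eq_self] at haA
      exact hx haA
    · exact hx (hA _ haA x (plt_up (by omega) (hxn q)) ⟨i, by simp [hiq]⟩)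
  have hY : line y i m ⊆ A := by
    intro a ha
    obtain ⟨v, ⟨hv, hvm⟩, rfl⟩ := mem_line.1 ha
    by_cases hv1 : v = y i
    · rw [hv1, Function.update_eq_self]; exact hy
    · have : (v : ℕ) ≠ y i := fun e => hv1 (Fin.ext e)
      exact hA y hy _ (plt_down (by omega) hv) ⟨q, by simp [Ne.symm hiq]⟩
  -- comparison
  have hcmp : ∀ a b : Fin N → Fin (k+1), zc a = 0 → zc b = 0 → b q = y q → (a q : ℕ) < y q →
      (∀ j, (a j : ℕ) ≤ x j ∨ (a j : ℕ) < y q) → plt a b := by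
    intro a b ha hb hbq haq h
    refine plt_of_TW q (by omega) ⟨?_, ?_⟩
    · rw [hbq]; intro e; rw [e] at haq; omega
    · intro j _
      rw [hbq]
      have h1 := hT1 j
      have h2 := h j
      by_cases e : (a j : ℕ) < y q
      · left; exact e
      · right
        rcases h1 with h1 | h1
        · omega
        · exact ⟨by omega, h1.2⟩
  have hXY : ∀ a ∈ line x q m, ∀ b ∈ line y i m, plt a b := by
    intro a ha b hb
    obtain ⟨v, ⟨hv, hvm⟩, rfl⟩ := mem_line.1 ha
    obtain ⟨v', ⟨hv', hvm'⟩, rfl⟩ := mem_line.1 hb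
    refine hcmp _ _ (by rw [zc_upne (hxn q) hv]; exact h0) (by rw [zc_upne (hyn i) hv']; exact hzy)
      (by simp [Ne.symm hiq]) (by simp; omega) ?_
    intro j
    by_cases hj : j = q
    · subst hj; right; simp; omega
    · left; simp [hj]
  have hXq : ∀ a ∈ line x q m, a q ≠ y q := by
    intro a ha
    obtain ⟨v, ⟨hv, hvm⟩, rfl⟩ := mem_line.1 ha
    rw [Function.update_self]; rintro rfl; omega
  set A' := (A \ line y i m) ∪ line x q m with hA'
  have hdisj : Disjoint (A \ line y i m) (line x q m) := by
    rw [Finset.disjoint_right]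
    intro a ha h
    exact hX a ha (mem_sdiff.1 h).1
  have hcard : A'.card = A.card := by
    rw [hA', card_union_of_disjoint hdisj, card_line, ← card_line (x := y) i m]
    exact Finset.card_sdiff_add_card_eq_card hY
  have hxA' : x ∈ A' := by
    refine mem_union_right _ (mem_line.2 ⟨x q, ⟨hxn q, ?_⟩, by simp⟩)
    have := hy2 i
    omega
  refine ⟨A', hcard, ?_, ?_⟩
  · have hmem : Function.update y i 0 ∈ dShadow A := mem_dS.2 ⟨y, hy, i, hyn i, rfl⟩
    have hsub : dShadow A' ⊆ insert (Function.update x q 0) ((dShadow A).erase (Function.update y i 0)) := by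
      intro u hu
      obtain ⟨a, ha, j, hj, rfl⟩ := mem_dS.1 hu
      have hne : Function.update a j 0 ≠ Function.update y i 0 := by
        intro e
        have hji : j = i := by
          by_contra hji
          exact hyn j (cover_eq e hji).1
        subst hji
        have e2 := cover_eq' e
        rcases mem_union.1 ha with h | h
        · rw [mem_sdiff] at h
          have hle : ¬ (a j : ℕ) ≤ m := fun hle => h.2 (mem_line.2 ⟨a j, ⟨hj, hle⟩, e2.symm⟩)
          have hlt : plt y a := by rw [e2]; exact plt_up (by omega) (hyn j)
          rcases hmax a h.1 with rfl | h'
          · exact plt_irrefl _ hlt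
          · exact plt_irrefl _ (plt_trans hlt h')
        · apply hXq a h
          rw [e2]; simp [Ne.symm hiq]
      rw [mem_insert, mem_erase]
      rcases mem_union.1 ha with h | h
      · right; exact ⟨hne, mem_dS.2 ⟨a, (mem_sdiff.1 h).1, j, hj, rfl⟩⟩
      · obtain ⟨v, ⟨hv, hvm⟩, rfl⟩ := mem_line.1 h
        by_cases hjq : j = q
        · left; subst hjq; simp
        · right
          refine ⟨hne, mem_dS.2 ⟨Function.update (Function.update x q v) j o, ?_, j, by simpa using ho0, by simp⟩⟩
          have hy'' : Function.update y j o ∈ A :=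
            hA y hy _ (plt_down (by have := hy2 j; omega) ho0) ⟨q, by simp [Ne.symm hjq]⟩
          have hc1 : zc (Function.update (Function.update x q v) j o) = 0 := by
            rw [zc_upne hj ho0, zc_upne (hxn q) hv, h0]
          refine hA _ hy'' _ (hcmp _ _ hc1 (by rw [zc_upne (hyn j) ho0, hzy]) (by simp [Ne.symm hjq])
            (by rw [Function.update_of_ne (Ne.symm hjq), Function.update_self]; omega) ?_) ⟨j, by simp⟩
          intro b
          by_cases hb : b = j
          · subst hb; right; rw [Function.update_self]; have := hy2 q; omega
          · rw [Function.update_of_ne hb]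
            by_cases hbq : b = q
            · subst hbq; right; rw [Function.update_self]; omega
            · left; rw [Function.update_of_ne hbq]
    have h1 := Finset.card_le_card hsub
    have h2 := Finset.card_insert_le (Function.update x q 0) ((dShadow A).erase (Function.update y i 0))
    have h3 := Finset.card_erase_add_one hmem
    omega
  · refine wsum wt A A' hcard ?_ (fun e => hx (e ▸ hxA'))
    intro b hb hbA a ha haA'
    apply wt_lt
    apply hXY
    · rcases mem_union.1 hb with h | h
      · exact absurd (mem_sdiff.1 h).1 hbA
      · exact h
    · by_contra h
      exact haA' (mem_union_left _ (mem_sdiff.2 ⟨ha, h⟩))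

end top

lemma exch_step {k N : ℕ} (A : Finset (Fin N → Fin (k + 1))) (hA : Closed A) (hni : ¬ isInitSeg A) :
    ∃ A' : Finset (Fin N → Fin (k + 1)), A'.card = A.card ∧
      (dShadow A').card ≤ (dShadow A).card ∧ ∑ x ∈ A', wt x < ∑ x ∈ A, wt x := by
  unfold isInitSeg at hni
  push Not at hni
  obtain ⟨y0, hy0, x0, hxy0, hx0⟩ := hni
  have hxy0 : plt x0 y0 := hxy0.resolve_left (by rintro rfl; exact hx0 hy0)
  obtain ⟨y, hy, hym⟩ := A.exists_max_image wt ⟨y0, hy0⟩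
  obtain ⟨x, hx, hxm⟩ := (univ \ A).exists_min_image wt ⟨x0, by simp [hx0]⟩
  have hx : x ∉ A := by simpa using hx
  have hmin : ∀ a, plt a x → a ∈ A := by
    intro a ha
    by_contra h
    have h1 := hxm a (by simp [h])
    have h2 := wt_lt ha
    omega
  have hmax : ∀ a ∈ A, a = y ∨ plt a y := by
    intro a ha
    rcases plt_total a y with h | h | h
    · right; exact h
    · left; exact h
    · have h1 := hym a ha
      have h2 := wt_lt h
      omega
  have hxy : plt x y := by
    apply plt_of_wt
    have h1 := hym y0 hy0
    have h2 := hxm x0 (by simp [hx0])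
    have h3 := wt_lt hxy0
    omega
  have hd : ∀ j, x j ≠ y j := fun j e => hx (hA y hy x hxy ⟨j, e⟩)
  have hz : ∀ z, plt x z → plt z y → (∃ j, z j = x j) → (∃ j, z j = y j) → False := by
    intro z h1 h2 ⟨j, h3⟩ h4
    exact hx (hA z (hA y hy z h2 h4) x h1 ⟨j, h3.symm⟩)
  have hw := exch_wt hx hy hxy
  by_cases hF : (Fs x).card ≤ (Fs y).card
  · exact ⟨_, hw.1, exch_card hy hxy hmin hmax hF, hw.2⟩
  by_cases hsp : ∀ i ∈ Fs x, Function.update x i 0 ∈ dShadow A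
  · refine ⟨_, hw.1, Finset.card_le_card ?_, hw.2⟩
    refine (exch_sub hxy hmin).trans (Finset.union_subset (Finset.Subset.refl _) ?_)
    intro u hu
    obtain ⟨i, hi, rfl⟩ := mem_image.1 hu
    exact hsp i hi
  push Not at hsp
  obtain ⟨i, hi, hiA⟩ := hsp
  have hi' := mem_Fs.1 hi
  have hx0 : x i ≠ 0 := ne_zero_of_val (by omega)
  by_cases hN : N ≤ 1
  · exfalso
    have hsub : ∀ j, j = i := fun j => by apply Fin.ext; omega
    have hx00 : zc x = 0 := by
      by_contra h
      obtain ⟨p, hp⟩ := exists_zero h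
      rw [hsub p] at hp
      exact hx0 hp
    have hyi : y i ≠ 0 := fun e => by
      have := zc_pos e
      have := plt_zc hxy
      omega
    apply hiA
    refine mem_dS.2 ⟨y, hy, i, hyi, ?_⟩
    funext j
    rw [hsub j]; simp
  by_cases h0 : zc x = 0
  · exact top_case (by omega) hx hy hA hxy hmax hd hz h0 (by omega)
  by_cases hN3 : 3 ≤ N
  · exact absurd (no_bad hN3 hxy hd hz h0) hF
  exfalso
  obtain ⟨p, hp⟩ := exists_zero h0
  have hne : p ≠ i := by rintro rfl; exact hx0 hp
  have hall : ∀ j, j = i ∨ j = p := by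
    intro j
    have h1 : (p : ℕ) ≠ i := fun e => hne (Fin.ext e)
    simp only [Fin.ext_iff]
    omega
  have hyp : y p ≠ 0 := fun e => hd p (by rw [hp, e])
  have hzA : Function.update y i 0 ∈ A := by
    by_cases h : y i = 0
    · rw [← h, Function.update_eq_self]; exact hy
    · exact hA y hy _ (plt_of_zc (by rw [zc_up0 h]; omega)) ⟨p, by simp [hne]⟩
  apply hiA
  refine mem_dS.2 ⟨_, hzA, p, by simpa [hne] using hyp, ?_⟩
  funext j
  rcases hall j with rfl | rfl
  · simp [Ne.symm hne]
  · simp [hne, hp]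

lemma good_all (k n : ℕ) : Good k n := by
  induction n with
  | zero =>
    intro A
    refine ⟨A, ?_, rfl, le_rfl⟩
    intro y hy x _
    rwa [Subsingleton.elim x y]
  | succ n ih =>
    intro A
    induction h : ∑ x ∈ A, wt x using Nat.strong_induction_on generalizing A with
    | _ m hm =>
      by_cases hI : isInitSeg A
      · exact ⟨A, hI, rfl, le_rfl⟩
      · obtain ⟨A', h1, h2, h3⟩ : ∃ A' : Finset (Fin (n + 1) → Fin (k + 1)), A'.card = A.card ∧
            (dShadow A').card ≤ (dShadow A).card ∧ ∑ x ∈ A', wt x < ∑ x ∈ A, wt x := by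
          by_cases hC : Closed A
          · exact exch_step A hC hI
          · exact compress_step ih A hC
        obtain ⟨B, hB1, hB2, hB3⟩ := hm _ (h ▸ h3) A' rfl
        exact ⟨B, hB1, hB2.trans h1, hB3.trans h2⟩

end ShadowAux

/-- **Theorem 1.** Let `k ≥ 1`, `n ≥ 1`, let `A ⊆ [k]^n` and let `B` be an initial
segment of the `≤`-order on `[k]^n` with `|B| = |A|`. Then `|d(A)| ≥ |d(B)|`.
(The alphabet `[k] = {0,…,k−1}` with `k ≥ 1` is rendered as `Fin (k+1)`.) -/
theorem thm_shadow_unrestricted (k n : ℕ) (hn : 1 ≤ n)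
    (A B : Finset (Fin n → Fin (k + 1)))
    (hB : isInitSeg B) (hcard : B.card = A.card) :
    (dShadow B).card ≤ (dShadow A).card := by

  obtain ⟨B', h1, h2, h3⟩ := ShadowAux.good_all k n A
  rw [ShadowAux.initseg_unique hB h1 (hcard.trans h2.symm)]
  exact h3
end

section
/- Let k ≥ 1, n ≥ 1 and 0 ≤ r ≤ n be integers, let A be a subset of [k]^n_r, and let B be an initial segment of the restriction of the ≤-order to [k]^n_r with |B| = |A|. Then |d(A)| ≥ |d(B)|. -/
open Finset
open scoped Classical

namespace SR

/-- locate a positive number in the block decomposition -/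
theorem exists_block (Nn : ℕ → ℕ) (h0 : Nn 0 = 0) (J e : ℕ) (he : 0 < e) (heJ : e ≤ Nn J) :
    ∃ i, i < J ∧ Nn i < e ∧ e ≤ Nn (i+1) := by
  induction J with
  | zero => omega
  | succ J ih =>
    by_cases h : e ≤ Nn J
    · obtain ⟨i, h1, h2, h3⟩ := ih h
      exact ⟨i, by omega, h2, h3⟩
    · exact ⟨J, by omega, by omega, heJ⟩

/-- numeric block structure -/
structure Blk (f g B Nn : ℕ → ℕ) : Prop where
  n0 : Nn 0 = 0
  ns : ∀ j, Nn (j+1) = Nn j + B j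
  mono : Monotone B
  g0 : g 0 = 0
  fb : ∀ j s, s ≤ B j → f (Nn j + s) = f (Nn j) + g s
  gsub : ∀ j s c, s + c ≤ B j → g (s + c) ≤ g s + g c
  gfin : ∀ j s c, s + c ≤ B j → g (B j) + g s ≤ g (B j - c) + g (s + c)

variable {f g B Nn : ℕ → ℕ}

theorem Blk.fin1 (H : Blk f g B Nn) (j : ℕ) : ∀ c s, c ≤ B j → s + c ≤ Nn (j+1) →
    g (B j) + f s ≤ g (B j - c) + f (s + c) := by
  intro c
  induction c using Nat.strong_induction_on with
  | _ c ih =>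
    intro s hc hs
    rcases Nat.eq_zero_or_pos c with rfl | hcp
    · simp
    obtain ⟨i, hi, h1, h2⟩ := exists_block Nn H.n0 (j+1) (s+c) (by omega) hs
    have hBi : B i ≤ B j := H.mono (by omega)
    have hns := H.ns i
    by_cases hsi : Nn i ≤ s
    · have e1 := H.fb i (s - Nn i) (by omega)
      have e2 := H.fb i (s - Nn i + c) (by omega)
      rw [show Nn i + (s - Nn i) = s by omega] at e1
      rw [show Nn i + (s - Nn i + c) = s + c by omega] at e2
      have := H.gfin j (s - Nn i) c (by omega)
      omega
    · have e2 := H.fb i (s + c - Nn i) (by omega)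
      rw [show Nn i + (s + c - Nn i) = s + c by omega] at e2
      have e3 := ih (Nn i - s) (by omega) s (by omega) (by omega)
      rw [show s + (Nn i - s) = Nn i by omega] at e3
      have e4 := H.gsub j (B j - c) (s + c - Nn i) (by omega)
      rw [show B j - c + (s + c - Nn i) = B j - (Nn i - s) by omega] at e4
      omega

theorem Blk.fin (H : Blk f g B Nn) : ∀ j s c, s + c ≤ Nn j →
    f (Nn j) + f s ≤ f (Nn j - c) + f (s + c) := by
  intro j
  induction j with
  | zero =>
    intro s c h
    have := H.n0
    have h1 : s = 0 := by omega
    have h2 : c = 0 := by omega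
    subst h1 h2; simp
  | succ j ih =>
    intro s c h
    have hns := H.ns j
    have e0 := H.fb j (B j) le_rfl
    rw [← hns] at e0
    by_cases hc : c ≤ B j
    · have e1 := H.fin1 j c s hc h
      have e2 := H.fb j (B j - c) (by omega)
      rw [show Nn j + (B j - c) = Nn (j+1) - c by omega] at e2
      omega
    · have e1 := ih s (c - B j) (by omega)
      have e2 := H.fin1 j (B j) (s + (c - B j)) le_rfl (by omega)
      rw [show s + (c - B j) + B j = s + c by omega, Nat.sub_self, H.g0] at e2
      rw [show Nn j - (c - B j) = Nn (j+1) - c by omega] at e1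
      omega

theorem Blk.sub (H : Blk f g B Nn) (i J : ℕ) : ∀ c, c ≤ B i → c ≤ Nn J → g c + f 0 ≤ f c := by
  intro c
  induction c using Nat.strong_induction_on with
  | _ c ih =>
    intro hc hJ
    rcases Nat.eq_zero_or_pos c with rfl | hcp
    · simp [H.g0]
    obtain ⟨h, hi, h1, h2⟩ := exists_block Nn H.n0 J c hcp hJ
    have hns := H.ns h
    have e1 := H.fb h (c - Nn h) (by omega)
    rw [show Nn h + (c - Nn h) = c by omega] at e1
    have e2 := H.gsub i (Nn h) (c - Nn h) (by omega)
    rw [show Nn h + (c - Nn h) = c by omega] at e2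
    have e3 := ih (Nn h) h1 (by omega) (by omega)
    omega

theorem Blk.subadd (H : Blk f g B Nn) (J s c : ℕ) (h : s + c ≤ Nn J) :
    f (s + c) + f 0 ≤ f s + f c := by
  rcases Nat.eq_zero_or_pos s with rfl | hsp
  · simp [add_comm]
  rcases Nat.eq_zero_or_pos c with rfl | hcp
  · simp
  obtain ⟨i, hi, h1, h2⟩ := exists_block Nn H.n0 J (s+c) (by omega) h
  have hns := H.ns i
  have key : ∀ s c : ℕ, s + c ≤ Nn J → Nn i < s + c → s + c ≤ Nn (i+1) → Nn i ≤ s →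
      f (s + c) + f 0 ≤ f s + f c := by
    intro s c h h1 h2 h3
    have e1 := H.fb i (s - Nn i) (by omega)
    have e2 := H.fb i (s - Nn i + c) (by omega)
    rw [show Nn i + (s - Nn i) = s by omega] at e1
    rw [show Nn i + (s - Nn i + c) = s + c by omega] at e2
    have e3 := H.gsub i (s - Nn i) c (by omega)
    have e4 := H.sub i J c (by omega) (by omega)
    omega
  by_cases hs : Nn i ≤ s
  · exact key s c h h1 h2 hs
  by_cases hc : Nn i ≤ c
  · have := key c s (by omega) (by omega) (by omega) hc
    rw [add_comm s c]; omega
  have e1 := H.fin i (s + c - Nn i) (Nn i - s) (by omega)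
  rw [show Nn i - (Nn i - s) = s by omega,
    show s + c - Nn i + (Nn i - s) = c by omega] at e1
  have e2 := H.fb i (s + c - Nn i) (by omega)
  rw [show Nn i + (s + c - Nn i) = s + c by omega] at e2
  have e3 := H.sub i J (s + c - Nn i) (by omega) (by omega)
  omega

theorem Blk.cross (H : Blk f g B Nn) (j s l : ℕ) (hs : s ≤ B j) (hl : l ≤ B j) :
    f (Nn j + s + l) ≤ f (Nn j + s) + g l := by
  have e1 := H.fb j s hs
  by_cases h : s + l ≤ B j
  · have e2 := H.fb j (s + l) h
    have e3 := H.gsub j s l h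
    rw [add_assoc]; omega
  · have hB : B j ≤ B (j+1) := H.mono (by omega)
    have e2 := H.fb j (B j) le_rfl
    have hns := H.ns j
    have e3 := H.fb (j+1) (s + l - B j) (by omega)
    rw [show Nn (j+1) + (s + l - B j) = Nn j + s + l by omega, hns] at e3
    have e4 := H.gfin j (s + l - B j) (B j - s) (by omega)
    rw [show B j - (B j - s) = s by omega, show s + l - B j + (B j - s) = l by omega] at e4
    omega

end SR

namespace SR
variable {N : ℕ}

/-- support -/
noncomputable def supp (x : Fin N → ℕ) : Finset (Fin N) := univ.filter fun i => x i ≠ 0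

/-- index of the vertex `(i, m)` -/
def vt (i : Fin N) (m : ℕ) : ℕ := (m - 1) * N + i

/-- colex code -/
noncomputable def code (x : Fin N → ℕ) : ℕ := ∑ i ∈ supp x, 2 ^ vt i (x i)

/-- rank `r` functions supported in `C` -/
def U (C : Finset (Fin N)) (r : ℕ) (x : Fin N → ℕ) : Prop := supp x ⊆ C ∧ (supp x).card = r

/-- shadow -/
noncomputable def sh (A : Finset (Fin N → ℕ)) : Finset (Fin N → ℕ) :=
  A.biUnion fun x => (supp x).image fun i => Function.update x i 0

/-- put value `m` on coordinate `p` -/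
noncomputable def put (L : Finset (Fin N → ℕ)) (p : Fin N) (m : ℕ) : Finset (Fin N → ℕ) :=
  L.image fun l => Function.update l p m

def IsInit (C : Finset (Fin N)) (r : ℕ) (B : Finset (Fin N → ℕ)) : Prop :=
  (∀ x ∈ B, U C r x) ∧ ∀ y ∈ B, ∀ x, U C r x → code x ≤ code y → x ∈ B

theorem mem_supp {x : Fin N → ℕ} {i : Fin N} : i ∈ supp x ↔ x i ≠ 0 := by simp [supp]

theorem mem_sh {A : Finset (Fin N → ℕ)} {z : Fin N → ℕ} :
    z ∈ sh A ↔ ∃ x ∈ A, ∃ i, x i ≠ 0 ∧ Function.update x i 0 = z := by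
  simp [sh, mem_supp]

theorem mem_put {L : Finset (Fin N → ℕ)} {p : Fin N} {m : ℕ} {z : Fin N → ℕ} :
    z ∈ put L p m ↔ ∃ l ∈ L, Function.update l p m = z := by
  simp [put]

theorem sh_mono {A B : Finset (Fin N → ℕ)} (h : A ⊆ B) : sh A ⊆ sh B := by
  intro z hz
  rw [mem_sh] at hz ⊢
  obtain ⟨x, hx, i, hi⟩ := hz
  exact ⟨x, h hx, i, hi⟩

theorem sh_union (A B : Finset (Fin N → ℕ)) : sh (A ∪ B) = sh A ∪ sh B := by
  simp [sh, Finset.union_biUnion]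

theorem supp_update_zero (x : Fin N → ℕ) (i : Fin N) :
    supp (Function.update x i 0) = (supp x).erase i := by
  ext j
  by_cases h : j = i
  · subst h; simp [mem_supp]
  · simp [mem_supp, h]

theorem supp_update_ne (x : Fin N → ℕ) (i : Fin N) (m : ℕ) (hm : m ≠ 0) :
    supp (Function.update x i m) = insert i (supp x) := by
  ext j
  by_cases h : j = i
  · subst h; simp [mem_supp, hm]
  · simp [mem_supp, h]

theorem U_update_zero {C : Finset (Fin N)} {r : ℕ} {x : Fin N → ℕ} {i : Fin N}
    (h : U C (r+1) x) (hi : x i ≠ 0) : U (C.erase i) r (Function.update x i 0) := by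
  constructor
  · rw [supp_update_zero]; exact Finset.erase_subset_erase _ h.1
  · rw [supp_update_zero, Finset.card_erase_of_mem (mem_supp.2 hi), h.2]; rfl

theorem U_erase {C : Finset (Fin N)} {r : ℕ} {x : Fin N → ℕ} {p : Fin N} :
    U (C.erase p) r x ↔ U C r x ∧ x p = 0 := by
  unfold U
  rw [Finset.subset_erase, mem_supp]
  tauto

theorem U_mono {C D : Finset (Fin N)} {r : ℕ} {x : Fin N → ℕ} (h : U C r x) (hCD : C ⊆ D) :
    U D r x := ⟨h.1.trans hCD, h.2⟩

theorem U_update_ne {C : Finset (Fin N)} {r : ℕ} {x : Fin N → ℕ} {i : Fin N} {m : ℕ}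
    (h : U C r x) (hi : x i = 0) (hC : i ∈ C) (hm : m ≠ 0) :
    U C (r+1) (Function.update x i m) := by
  constructor
  · rw [supp_update_ne _ _ _ hm]; exact Finset.insert_subset hC h.1
  · rw [supp_update_ne _ _ _ hm, Finset.card_insert_of_notMem (by simp [mem_supp, hi]), h.2]

theorem vt_inj {i j : Fin N} {m n : ℕ} (hm : m ≠ 0) (hn : n ≠ 0) (h : vt i m = vt j n) :
    i = j ∧ m = n := by
  unfold vt at h
  have hN : 0 < N := i.pos
  have h1 : ((m-1)*N + i) % N = i := by
    rw [Nat.mul_add_mod_self_right, Nat.mod_eq_of_lt i.2]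
  have h2 : ((n-1)*N + j) % N = j := by
    rw [Nat.mul_add_mod_self_right, Nat.mod_eq_of_lt j.2]
  have hij : (i : ℕ) = j := by rw [← h1, h, h2]
  have : (m-1)*N = (n-1)*N := by omega
  have := Nat.eq_of_mul_eq_mul_right hN this
  exact ⟨Fin.ext hij, by omega⟩

theorem vt_mono {i : Fin N} {m n : ℕ} (h : m ≤ n) : vt i m ≤ vt i n := by
  unfold vt
  have : (m-1)*N ≤ (n-1)*N := Nat.mul_le_mul_right _ (by omega)
  omega

theorem vt_lt {i j : Fin N} {m n : ℕ} (hm : m ≠ 0) (h : m < n) : vt i m < vt j n := by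
  unfold vt
  have : (m-1+1)*N ≤ (n-1)*N := Nat.mul_le_mul_right _ (by omega)
  have := i.2
  rw [add_mul] at *
  omega

theorem vt_le_val {i j : Fin N} {m n : ℕ} (hn : n ≠ 0) (h : vt i m ≤ vt j n) : m ≤ n := by
  by_contra hlt
  have := vt_lt (i := j) (j := i) hn (not_le.1 hlt)
  omega

/-- set of vertices -/
noncomputable def vset (x : Fin N → ℕ) : Finset ℕ := (supp x).image fun i => vt i (x i)

theorem code_eq (x : Fin N → ℕ) : code x = ∑ q ∈ vset x, 2 ^ q := by
  unfold code vset
  rw [Finset.sum_image]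
  intro i hi j hj h
  exact (vt_inj (mem_supp.1 hi) (mem_supp.1 hj) h).1

theorem mem_vset {x : Fin N → ℕ} {q : ℕ} : q ∈ vset x ↔ ∃ i, x i ≠ 0 ∧ vt i (x i) = q := by
  simp [vset, mem_supp]

theorem vt_mem_vset {x : Fin N → ℕ} {i : Fin N} {m : ℕ} (hm : m ≠ 0) :
    vt i m ∈ vset x ↔ x i = m := by
  rw [mem_vset]
  constructor
  · rintro ⟨j, hj, h⟩
    obtain ⟨rfl, h2⟩ := vt_inj hj hm h
    exact h2
  · rintro rfl; exact ⟨i, hm, rfl⟩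

theorem vset_inj {x y : Fin N → ℕ} (h : vset x = vset y) : x = y := by
  funext i
  by_cases hx : x i = 0
  · by_contra hne
    have hy : y i ≠ 0 := by omega
    have : vt i (y i) ∈ vset x := by rw [h, vt_mem_vset hy]
    rw [vt_mem_vset hy] at this
    omega
  · have : vt i (x i) ∈ vset y := by rw [← h, vt_mem_vset hx]
    rw [vt_mem_vset hx] at this
    exact this.symm

theorem code_inj {x y : Fin N → ℕ} (h : code x = code y) : x = y := by
  rw [code_eq, code_eq] at h
  exact vset_inj (Finset.geomSum_injective le_rfl h)

theorem code_lt_pow {x : Fin N → ℕ} {q : ℕ} :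
    code x < 2 ^ q ↔ ∀ i, x i ≠ 0 → vt i (x i) < q := by
  constructor
  · intro h i hi
    have h1 : 2 ^ vt i (x i) ≤ code x :=
      Finset.single_le_sum (f := fun i => 2 ^ vt i (x i)) (fun _ _ => Nat.zero_le _) (mem_supp.2 hi)
    exact (Nat.pow_lt_pow_iff_right (by norm_num)).1 (lt_of_le_of_lt h1 h)
  · intro h
    rw [code_eq]
    apply Nat.geomSum_lt le_rfl
    intro k hk
    obtain ⟨i, hi, rfl⟩ := mem_vset.1 hk
    exact h i hi

theorem pow_le_code {x : Fin N → ℕ} {i : Fin N} {m : ℕ} (hm : m ≠ 0) (h : x i = m) :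
    2 ^ vt i m ≤ code x := by
  subst h
  by_contra hlt
  exact lt_irrefl _ (code_lt_pow.1 (not_le.1 hlt) i hm)

theorem code_update_ne {y : Fin N → ℕ} {p : Fin N} {m : ℕ} (hy : y p = 0) (hm : m ≠ 0) :
    code (Function.update y p m) = 2 ^ vt p m + code y := by
  unfold code
  rw [supp_update_ne _ _ _ hm, Finset.sum_insert (by simp [mem_supp, hy])]
  simp only [Function.update_self]
  congr 1
  apply Finset.sum_congr rfl
  intro i hi
  have : i ≠ p := by rintro rfl; exact mem_supp.1 hi hy
  rw [Function.update_of_ne this]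

theorem update_update_zero {y : Fin N → ℕ} {p : Fin N} {m : ℕ} (hy : y p = 0) :
    Function.update (Function.update y p m) p 0 = y := by
  rw [Function.update_idem, ← hy, Function.update_eq_self]

theorem update_zero_update {x : Fin N → ℕ} {p : Fin N} :
    Function.update (Function.update x p 0) p (x p) = x := by
  rw [Function.update_idem, Function.update_eq_self]

theorem code_update_zero {x : Fin N → ℕ} {p : Fin N} (hx : x p ≠ 0) :
    code x = 2 ^ vt p (x p) + code (Function.update x p 0) := by
  conv_lhs => rw [← update_zero_update (x := x) (p := p)]
  rw [code_update_ne (by simp) hx]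

theorem code_update_zero_lt {x : Fin N → ℕ} {p : Fin N} (hx : x p ≠ 0) :
    code (Function.update x p 0) < code x := by
  rw [code_update_zero hx]
  have : 0 < 2 ^ vt p (x p) := by positivity
  omega

/-- order cancellation of a common coordinate -/
theorem code_update_le_iff {y z : Fin N → ℕ} {p : Fin N} {m : ℕ} (hy : y p = 0) (hz : z p = 0) :
    code (Function.update y p m) ≤ code (Function.update z p m) ↔ code y ≤ code z := by
  by_cases hm : m = 0
  · subst hm
    rw [← hy, Function.update_eq_self, hy, ← hz, Function.update_eq_self]
  · rw [code_update_ne hy hm, code_update_ne hz hm]; omega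

theorem top_vertex {x : Fin N → ℕ} {q : ℕ} (h1 : 2 ^ q ≤ code x) (h2 : code x < 2 ^ (q+1)) :
    ∃ i, x i ≠ 0 ∧ vt i (x i) = q := by
  by_contra hcon
  push Not at hcon
  have : code x < 2 ^ q := by
    rw [code_lt_pow] at h2 ⊢
    intro i hi
    have := h2 i hi
    have := hcon i hi
    omega
  omega

theorem exists_top {x : Fin N → ℕ} (hx : (supp x).Nonempty) :
    ∃ p, x p ≠ 0 ∧ 2 ^ vt p (x p) ≤ code x ∧ code x < 2 ^ (vt p (x p) + 1) := by
  have hpos : code x ≠ 0 := by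
    obtain ⟨i, hi⟩ := hx
    have := pow_le_code (mem_supp.1 hi) (rfl : x i = x i)
    have : 0 < 2 ^ vt i (x i) := by positivity
    omega
  have h1 := Nat.pow_log_le_self 2 hpos
  have h2 := Nat.lt_pow_succ_log_self (by norm_num : 1 < 2) (code x)
  obtain ⟨p, hp, hq⟩ := top_vertex h1 h2
  exact ⟨p, hp, by rw [hq]; exact h1, by rw [hq]; exact h2⟩

theorem finite_below (C : Finset (Fin N)) (r c : ℕ) : {x | U C r x ∧ code x < c}.Finite := by
  apply Set.Finite.of_finite_image (f := code)
  · exact (Set.finite_Iio c).subset (by rintro _ ⟨x, hx, rfl⟩; exact hx.2)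
  · intro x _ y _ h; exact code_inj h

/-- all elements of code below `c` -/
noncomputable def Bel (C : Finset (Fin N)) (r c : ℕ) : Finset (Fin N → ℕ) :=
  (finite_below C r c).toFinset

theorem mem_Bel {C : Finset (Fin N)} {r c : ℕ} {x : Fin N → ℕ} :
    x ∈ Bel C r c ↔ U C r x ∧ code x < c := by simp [Bel]

theorem isInit_Bel (C : Finset (Fin N)) (r c : ℕ) : IsInit C r (Bel C r c) := by
  refine ⟨fun x hx => (mem_Bel.1 hx).1, fun y hy x hx h => ?_⟩
  rw [mem_Bel] at *
  exact ⟨hx, by omega⟩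

theorem isInit_empty (C : Finset (Fin N)) (r : ℕ) : IsInit C r ∅ :=
  ⟨by simp, by simp⟩

theorem IsInit.subset_or {C : Finset (Fin N)} {r : ℕ} {B D : Finset (Fin N → ℕ)}
    (hB : IsInit C r B) (hD : IsInit C r D) : B ⊆ D ∨ D ⊆ B := by
  by_contra hcon
  push Not at hcon
  obtain ⟨h1, h2⟩ := hcon
  obtain ⟨x, hx, hx'⟩ := Finset.not_subset.1 h1
  obtain ⟨y, hy, hy'⟩ := Finset.not_subset.1 h2
  rcases le_total (code x) (code y) with h | h
  · exact hx' (hD.2 y hy x (hB.1 x hx) h)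
  · exact hy' (hB.2 x hx y (hD.1 y hy) h)

theorem IsInit.subset_of_card {C : Finset (Fin N)} {r : ℕ} {B D : Finset (Fin N → ℕ)}
    (hB : IsInit C r B) (hD : IsInit C r D) (h : B.card ≤ D.card) : B ⊆ D := by
  rcases hB.subset_or hD with h1 | h1
  · exact h1
  · rw [Finset.eq_of_subset_of_card_le h1 h]

theorem IsInit.eq_of_card {C : Finset (Fin N)} {r : ℕ} {B D : Finset (Fin N → ℕ)}
    (hB : IsInit C r B) (hD : IsInit C r D) (h : B.card = D.card) : B = D :=
  (hB.subset_of_card hD h.le).antisymm (hD.subset_of_card hB h.ge)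

theorem exists_init {C : Finset (Fin N)} {r : ℕ} {A : Finset (Fin N → ℕ)}
    (hA : ∀ x ∈ A, U C r x) : ∀ a, a ≤ A.card → ∃ B, IsInit C r B ∧ B.card = a := by
  intro a
  induction a with
  | zero => intro _; exact ⟨∅, isInit_empty C r, rfl⟩
  | succ a ih =>
    intro h
    obtain ⟨B, hB, hBa⟩ := ih (by omega)
    have hne : (A \ B).Nonempty := by
      rw [Finset.sdiff_nonempty]
      intro hs
      have := Finset.card_le_card hs
      omega
    obtain ⟨x0, hx0⟩ := hne
    rw [Finset.mem_sdiff] at hx0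
    have hex : ∃ c, ∃ x, U C r x ∧ x ∉ B ∧ code x = c := ⟨_, x0, hA _ hx0.1, hx0.2, rfl⟩
    obtain ⟨x, hx, hxB, hxc⟩ := Nat.find_spec hex
    refine ⟨insert x B, ⟨?_, ?_⟩, by rw [Finset.card_insert_of_notMem hxB, hBa]⟩
    · intro y hy
      rcases Finset.mem_insert.1 hy with rfl | hy
      · exact hx
      · exact hB.1 y hy
    · intro y hy z hz hzy
      by_contra hzB
      rw [Finset.mem_insert, not_or] at hzB
      have h1 := Nat.find_min' hex ⟨z, hz, hzB.2, rfl⟩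
      rcases Finset.mem_insert.1 hy with rfl | hy
      · exact hzB.1 (code_inj (by omega))
      · exact hzB.2 (hB.2 y hy z hz hzy)

/-- initial segments have the smallest code sums -/
theorem sum_code_lt {C : Finset (Fin N)} {r : ℕ} {A B : Finset (Fin N → ℕ)}
    (hA : ∀ x ∈ A, U C r x) (hB : IsInit C r B) (hc : B.card = A.card) (hne : B ≠ A) :
    ∑ x ∈ B, code x < ∑ x ∈ A, code x := by
  have h1 : ∑ x ∈ B, code x = ∑ x ∈ B \ A, code x + ∑ x ∈ B ∩ A, code x := by
    rw [add_comm]; exact (Finset.sum_inter_add_sum_sdiff B A _).symm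
  have h2 : ∑ x ∈ A, code x = ∑ x ∈ A \ B, code x + ∑ x ∈ B ∩ A, code x := by
    rw [add_comm, Finset.inter_comm]; exact (Finset.sum_inter_add_sum_sdiff A B _).symm
  rw [h1, h2]
  have hcard : (B \ A).card = (A \ B).card := by
    have e1 := Finset.card_sdiff_add_card_inter B A
    have e2 := Finset.card_sdiff_add_card_inter A B
    rw [Finset.inter_comm] at e2
    omega
  have hne1 : (B \ A).Nonempty := by
    rw [Finset.sdiff_nonempty]
    intro hs
    exact hne (Finset.eq_of_subset_of_card_le hs hc.ge)
  obtain ⟨m, hm, hmax⟩ := Finset.exists_max_image (B \ A) code hne1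
  have hlt : ∀ y ∈ A \ B, code m + 1 ≤ code y := by
    intro y hy
    rw [Finset.mem_sdiff] at hy hm
    by_contra hcon
    exact hy.2 (hB.2 m hm.1 y (hA y hy.1) (by omega))
  have e1 : ∑ x ∈ B \ A, code x ≤ (B \ A).card • code m := Finset.sum_le_card_nsmul _ _ _ hmax
  have e2 : (A \ B).card • (code m + 1) ≤ ∑ x ∈ A \ B, code x :=
    Finset.card_nsmul_le_sum _ _ _ hlt
  rw [← hcard] at e2
  have hp := hne1.card_pos
  simp only [smul_eq_mul, mul_add, mul_one] at e1 e2
  omega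

theorem sum_code_le {C : Finset (Fin N)} {r : ℕ} {A B : Finset (Fin N → ℕ)}
    (hA : ∀ x ∈ A, U C r x) (hB : IsInit C r B) (hc : B.card = A.card) :
    ∑ x ∈ B, code x ≤ ∑ x ∈ A, code x := by
  by_cases h : B = A
  · rw [h]
  · exact (sum_code_lt hA hB hc h).le

end SR

namespace SR
variable {N : ℕ}

/-- slice -/
noncomputable def sl (B : Finset (Fin N → ℕ)) (p : Fin N) (m : ℕ) : Finset (Fin N → ℕ) :=
  (B.filter fun x => x p = m).image fun x => Function.update x p 0

theorem mem_sl {B : Finset (Fin N → ℕ)} {p : Fin N} {m : ℕ} {l : Fin N → ℕ} :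
    l ∈ sl B p m ↔ l p = 0 ∧ Function.update l p m ∈ B := by
  unfold sl
  simp only [Finset.mem_image, Finset.mem_filter]
  constructor
  · rintro ⟨x, ⟨hx, rfl⟩, rfl⟩
    refine ⟨by simp, ?_⟩
    rw [update_zero_update]; exact hx
  · rintro ⟨h0, h1⟩
    exact ⟨_, ⟨h1, by simp⟩, update_update_zero h0⟩

theorem card_put {L : Finset (Fin N → ℕ)} {p : Fin N} {m : ℕ} (h : ∀ l ∈ L, l p = 0) :
    (put L p m).card = L.card := by
  unfold put
  apply Finset.card_image_of_injOn
  intro x hx y hy hxy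
  simp only at hxy
  rw [← update_update_zero (m := m) (h x hx), hxy, update_update_zero (h y hy)]

theorem put_sl {B : Finset (Fin N → ℕ)} {p : Fin N} {m : ℕ} :
    put (sl B p m) p m = B.filter fun x => x p = m := by
  ext x
  rw [mem_put, Finset.mem_filter]
  constructor
  · rintro ⟨l, hl, rfl⟩
    exact ⟨(mem_sl.1 hl).2, by simp⟩
  · rintro ⟨hx, rfl⟩
    exact ⟨Function.update x p 0, mem_sl.2 ⟨by simp, by rwa [update_zero_update]⟩,
      update_zero_update⟩

theorem sl_U {C : Finset (Fin N)} {r : ℕ} {A : Finset (Fin N → ℕ)} {p : Fin N} {m : ℕ}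
    (hA : ∀ x ∈ A, U C (r+1) x) (hm : m ≠ 0) : ∀ l ∈ sl A p m, U (C.erase p) r l := by
  intro l hl
  rw [mem_sl] at hl
  have := U_update_zero (i := p) (hA _ hl.2) (by simpa using hm)
  rwa [update_update_zero hl.1] at this

theorem sl_U_zero {C : Finset (Fin N)} {r : ℕ} {A : Finset (Fin N → ℕ)} {p : Fin N}
    (hA : ∀ x ∈ A, U C r x) : ∀ l ∈ sl A p 0, U (C.erase p) r l := by
  intro l hl
  rw [mem_sl] at hl
  have h := hA _ hl.2
  rw [show Function.update l p 0 = l by rw [← hl.1, Function.update_eq_self]] at h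
  exact U_erase.2 ⟨h, hl.1⟩

theorem isInit_sl {C : Finset (Fin N)} {r : ℕ} {B : Finset (Fin N → ℕ)} {p : Fin N} {m : ℕ}
    (hB : IsInit C (r+1) B) (hp : p ∈ C) (hm : m ≠ 0) : IsInit (C.erase p) r (sl B p m) := by
  refine ⟨sl_U hB.1 hm, ?_⟩
  intro y hy x hx hxy
  rw [mem_sl] at hy ⊢
  obtain ⟨hx1, hx2⟩ := U_erase.1 hx
  refine ⟨hx2, hB.2 _ hy.2 _ (U_update_ne hx1 hx2 hp hm) ?_⟩
  rwa [code_update_le_iff hx2 hy.1]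

/-- decomposition of an initial segment around the block of the vertex `(p, m)` -/
theorem block_eq {C : Finset (Fin N)} {r : ℕ} {B : Finset (Fin N → ℕ)} {p : Fin N} {m : ℕ}
    (hm : m ≠ 0) (hU : ∀ x ∈ B, U C (r+1) x)
    (h1 : Bel C (r+1) (2 ^ vt p m) ⊆ B)
    (h2 : ∀ x ∈ B, code x < 2 ^ (vt p m + 1)) :
    B = Bel C (r+1) (2 ^ vt p m) ∪ put (sl B p m) p m := by
  rw [put_sl]
  ext x
  rw [Finset.mem_union, Finset.mem_filter]
  constructor
  · intro hx
    by_cases hlt : code x < 2 ^ vt p m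
    · exact Or.inl (mem_Bel.2 ⟨hU x hx, hlt⟩)
    · obtain ⟨i, hi, hv⟩ := top_vertex (not_lt.1 hlt) (h2 x hx)
      obtain ⟨rfl, hv2⟩ := vt_inj hi hm hv
      exact Or.inr ⟨hx, hv2⟩
  · rintro (hx | hx)
    · exact h1 hx
    · exact hx.1

theorem sl_lt {B : Finset (Fin N → ℕ)} {p : Fin N} {m : ℕ} (hm : m ≠ 0)
    (h2 : ∀ x ∈ B, code x < 2 ^ (vt p m + 1)) : ∀ l ∈ sl B p m, code l < 2 ^ vt p m := by
  intro l hl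
  rw [mem_sl] at hl
  have := h2 _ hl.2
  rw [code_update_ne hl.1 hm, pow_succ] at this
  omega

theorem disj_block {C : Finset (Fin N)} {r : ℕ} {L : Finset (Fin N → ℕ)} {p : Fin N} {m : ℕ}
    (hm : m ≠ 0) : Disjoint (Bel C r (2 ^ vt p m)) (put L p m) := by
  rw [Finset.disjoint_left]
  intro x hx hx'
  obtain ⟨l, hl, rfl⟩ := mem_put.1 hx'
  have h1 := (mem_Bel.1 hx).2
  have h2 := pow_le_code (x := Function.update l p m) (i := p) hm (by simp)
  omega

theorem init_block {C : Finset (Fin N)} {r : ℕ} {L : Finset (Fin N → ℕ)} {p : Fin N} {m : ℕ}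
    (hp : p ∈ C) (hm : m ≠ 0) (hL : IsInit (C.erase p) r L)
    (hlt : ∀ l ∈ L, code l < 2 ^ vt p m) :
    IsInit C (r+1) (Bel C (r+1) (2 ^ vt p m) ∪ put L p m) := by
  have hL0 : ∀ l ∈ L, l p = 0 := fun l hl => (U_erase.1 (hL.1 l hl)).2
  constructor
  · intro x hx
    rcases Finset.mem_union.1 hx with hx | hx
    · exact (mem_Bel.1 hx).1
    · obtain ⟨l, hl, rfl⟩ := mem_put.1 hx
      exact U_update_ne (U_erase.1 (hL.1 l hl)).1 (hL0 l hl) hp hm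
  · intro y hy x hx hxy
    rw [Finset.mem_union]
    by_cases hxq : code x < 2 ^ vt p m
    · exact Or.inl (mem_Bel.2 ⟨hx, hxq⟩)
    · right
      rcases Finset.mem_union.1 hy with hy | hy
      · have := (mem_Bel.1 hy).2
        omega
      · obtain ⟨l, hl, rfl⟩ := mem_put.1 hy
        have hcl := code_update_ne (hL0 l hl) hm
        have := hlt l hl
        obtain ⟨i, hi, hv⟩ := top_vertex (not_lt.1 hxq) (by rw [pow_succ]; omega)
        obtain ⟨rfl, hv2⟩ := vt_inj hi hm hv
        subst hv2
        refine mem_put.2 ⟨Function.update x i 0, ?_, update_zero_update⟩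
        refine hL.2 l hl _ (U_update_zero hx hi) ?_
        rw [← code_update_le_iff (m := x i) (by simp) (hL0 l hl), update_zero_update]
        exact hxy

theorem sh_put_of {L : Finset (Fin N → ℕ)} {p : Fin N} {m : ℕ} (hm : m ≠ 0)
    (hL0 : ∀ l ∈ L, l p = 0) : sh (put L p m) = L ∪ put (sh L) p m := by
  ext z
  rw [Finset.mem_union, mem_sh, mem_put]
  constructor
  · rintro ⟨x, hx, i, hi, rfl⟩
    obtain ⟨l, hl, rfl⟩ := mem_put.1 hx
    by_cases hip : i = p
    · subst hip
      left; rwa [update_update_zero (hL0 l hl)]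
    · right
      rw [Function.update_of_ne hip] at hi
      exact ⟨Function.update l i 0, mem_sh.2 ⟨l, hl, i, hi, rfl⟩,
        Function.update_comm hip _ _ _⟩
  · rintro (hz | ⟨l', hl', rfl⟩)
    · exact ⟨Function.update z p m, mem_put.2 ⟨z, hz, rfl⟩, p, by simpa using hm,
        update_update_zero (hL0 z hz)⟩
    · obtain ⟨l, hl, i, hi, rfl⟩ := mem_sh.1 hl'
      have hip : i ≠ p := by rintro rfl; exact hi (hL0 l hl)
      exact ⟨Function.update l p m, mem_put.2 ⟨l, hl, rfl⟩, i,
        by rwa [Function.update_of_ne hip], (Function.update_comm hip _ _ _).symm⟩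

theorem sh_zero {L : Finset (Fin N → ℕ)} {p : Fin N} (hL0 : ∀ l ∈ L, l p = 0) :
    ∀ l ∈ sh L, l p = 0 := by
  intro z hz
  obtain ⟨l, hl, i, hi, rfl⟩ := mem_sh.1 hz
  by_cases hip : p = i
  · subst hip; simp
  · rw [Function.update_of_ne hip]; exact hL0 l hl

theorem sh_U {C : Finset (Fin N)} {r : ℕ} {A : Finset (Fin N → ℕ)}
    (hA : ∀ x ∈ A, U C (r+1) x) : ∀ z ∈ sh A, U C r z := by
  intro z hz
  obtain ⟨l, hl, i, hi, rfl⟩ := mem_sh.1 hz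
  exact U_mono (U_update_zero (hA l hl) hi) (Finset.erase_subset _ _)

/-- shadow of a block -/
theorem sh_block {C : Finset (Fin N)} {r : ℕ} {L : Finset (Fin N → ℕ)} {p : Fin N} {m : ℕ}
    (hp : p ∈ C) (hm : m ≠ 0) (hL : IsInit (C.erase p) r L)
    (hlt : ∀ l ∈ L, code l < 2 ^ vt p m)
    (hne : (Bel C (r+1) (2 ^ vt p m) ∪ put L p m).Nonempty) :
    sh (Bel C (r+1) (2 ^ vt p m) ∪ put L p m) = Bel C r (2 ^ vt p m) ∪ put (sh L) p m := by
  have hL0 : ∀ l ∈ L, l p = 0 := fun l hl => (U_erase.1 (hL.1 l hl)).2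
  have hin := init_block hp hm hL hlt
  apply Finset.Subset.antisymm
  · rw [sh_union, sh_put_of hm hL0]
    intro z hz
    simp only [Finset.mem_union] at hz ⊢
    rcases hz with hz | hz | hz
    · left
      obtain ⟨x, hx, i, hi, rfl⟩ := mem_sh.1 hz
      rw [mem_Bel] at hx ⊢
      exact ⟨U_mono (U_update_zero hx.1 hi) (Finset.erase_subset _ _),
        lt_trans (code_update_zero_lt hi) hx.2⟩
    · left
      exact mem_Bel.2 ⟨(U_erase.1 (hL.1 z hz)).1, hlt z hz⟩
    · exact Or.inr hz
  · apply Finset.union_subset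
    swap
    · rw [sh_union, sh_put_of hm hL0]
      intro z hz
      simp only [Finset.mem_union]
      exact Or.inr (Or.inr hz)
    intro z hz
    obtain ⟨hzU, hzq⟩ := mem_Bel.1 hz
    obtain ⟨b, hb⟩ := hne
    have hbU := hin.1 b hb
    have hbq : ∀ i, b i ≠ 0 → vt i (b i) ≤ vt p m := by
      have : code b < 2 ^ (vt p m + 1) := by
        rw [pow_succ]
        rcases Finset.mem_union.1 hb with hb | hb
        · have := (mem_Bel.1 hb).2
          omega
        · obtain ⟨l, hl, rfl⟩ := mem_put.1 hb
          rw [code_update_ne (hL0 l hl) hm]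
          have := hlt l hl
          omega
      intro i hi
      have := code_lt_pow.1 this i hi
      omega
    by_cases hex : ∃ i, b i ≠ 0 ∧ z i = 0 ∧ vt i 1 < vt p m
    · obtain ⟨i, hi, hzi, hiq⟩ := hex
      have hiC : i ∈ C := hbU.1 (mem_supp.2 hi)
      refine mem_sh.2 ⟨Function.update z i 1, ?_, i, by simp, update_update_zero hzi⟩
      refine Finset.mem_union_left _ (mem_Bel.2 ⟨U_update_ne hzU hzi hiC one_ne_zero, ?_⟩)
      rw [code_lt_pow] at hzq ⊢
      intro j hj
      by_cases hji : j = i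
      · subst hji; simpa using hiq
      · rw [Function.update_of_ne hji] at hj ⊢
        exact hzq j hj
    · push Not at hex
      have hp1 : ∀ i, b i ≠ 0 → z i = 0 → i = p ∧ m = 1 := by
        intro i hi hzi
        have h1 := hex i hi hzi
        have h2 : vt i 1 ≤ vt i (b i) := vt_mono (by omega)
        have h3 := hbq i hi
        obtain ⟨e1, e2⟩ := vt_inj one_ne_zero hm (by omega : vt i 1 = vt p m)
        exact ⟨e1, e2.symm⟩
      have hexi : ∃ i, b i ≠ 0 ∧ z i = 0 := by
        by_contra hcon
        push Not at hcon
        have : supp b ⊆ supp z := fun i hi => mem_supp.2 (hcon i (mem_supp.1 hi))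
        have := Finset.card_le_card this
        rw [hbU.2, hzU.2] at this
        omega
      obtain ⟨i, hi, hzi⟩ := hexi
      obtain ⟨rfl, rfl⟩ := hp1 i hi hzi
      have hsub : (supp b).erase i ⊆ supp z := by
        intro j hj
        rw [Finset.mem_erase, mem_supp] at hj
        rw [mem_supp]
        intro hzj
        exact hj.1 (hp1 j hj.2 hzj).1
      have heq : (supp b).erase i = supp z := by
        apply Finset.eq_of_subset_of_card_le hsub
        rw [Finset.card_erase_of_mem (mem_supp.2 hi), hbU.2, hzU.2]; rfl
      have hone : ∀ (j : Fin N) (n : ℕ), n ≠ 0 → vt j n ≤ vt i 1 → n = 1 := by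
        intro j n hn h
        have := vt_le_val one_ne_zero h
        omega
      have hbi : b i = 1 := hone i _ hi (hbq i hi)
      have hzb : Function.update b i 0 = z := by
        funext j
        by_cases hji : j = i
        · subst hji; simp [hzi]
        · rw [Function.update_of_ne hji]
          by_cases hbj : b j = 0
          · rw [hbj]
            by_contra hzj
            have : j ∈ (supp b).erase i := by rw [heq, mem_supp]; exact fun h => hzj h.symm
            exact mem_supp.1 (Finset.mem_of_mem_erase this) hbj
          · have hzj : z j ≠ 0 := by
              rw [← mem_supp, ← heq, Finset.mem_erase, mem_supp]; exact ⟨hji, hbj⟩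
            rw [hone j _ hbj (hbq j hbj), hone j _ hzj (code_lt_pow.1 hzq j hzj).le]
      exact mem_sh.2 ⟨b, hb, i, hi, hzb⟩

/-- every nonempty initial segment is a block -/
theorem exists_block_of_init {C : Finset (Fin N)} {r : ℕ} {B : Finset (Fin N → ℕ)}
    (hB : IsInit C (r+1) B) (hne : B.Nonempty) :
    ∃ p ∈ C, ∃ m, m ≠ 0 ∧ Bel C (r+1) (2 ^ vt p m) ⊆ B ∧
      (∀ x ∈ B, code x < 2 ^ (vt p m + 1)) := by
  obtain ⟨y, hy, hmax⟩ := Finset.exists_max_image B code hne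
  have hyU := hB.1 y hy
  obtain ⟨p, hp, h1, h2⟩ := exists_top (x := y)
    (by rw [← Finset.card_pos, hyU.2]; omega)
  refine ⟨p, hyU.1 (mem_supp.2 hp), y p, hp, ?_, ?_⟩
  · intro x hx
    obtain ⟨hxU, hxq⟩ := mem_Bel.1 hx
    exact hB.2 y hy x hxU (by omega)
  · intro x hx
    have := hmax x hx
    omega

theorem isInit_sh : ∀ (n : ℕ) (C : Finset (Fin N)), C.card = n → ∀ (r : ℕ)
    (B : Finset (Fin N → ℕ)), IsInit C (r+1) B → IsInit C r (sh B) := by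
  intro n
  induction n with
  | zero =>
    intro C hC r B hB
    rw [Finset.card_eq_zero] at hC
    subst hC
    have : B = ∅ := by
      apply Finset.eq_empty_of_forall_notMem
      intro x hx
      have := hB.1 x hx
      have h1 := Finset.subset_empty.1 this.1
      have h2 := this.2
      rw [h1] at h2
      simp at h2
    subst this
    exact isInit_empty _ _
  | succ n ih =>
    intro C hC r B hB
    rcases B.eq_empty_or_nonempty with rfl | hne
    · exact isInit_empty _ _
    obtain ⟨p, hp, m, hm, h1, h2⟩ := exists_block_of_init hB hne
    have hBeq := block_eq hm hB.1 h1 h2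
    have hL := isInit_sl (m := m) hB hp hm
    have hlt := sl_lt hm h2
    have hshB := sh_block hp hm hL hlt (by rwa [← hBeq])
    rw [← hBeq] at hshB
    rw [hshB]
    cases r with
    | zero =>
      have : sh (sl B p m) = ∅ := by
        apply Finset.eq_empty_of_forall_notMem
        intro z hz
        obtain ⟨l, hl, i, hi, rfl⟩ := mem_sh.1 hz
        have := (hL.1 l hl).2
        rw [Finset.card_eq_zero] at this
        have h3 := mem_supp.2 hi
        rw [this] at h3
        simp at h3
      rw [this]
      simpa [put] using isInit_Bel C 0 _
    | succ r =>
      refine init_block hp hm (ih (C.erase p) ?_ r _ hL) ?_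
      · rw [Finset.card_erase_of_mem hp, hC]; rfl
      · intro z hz
        obtain ⟨l, hl, i, hi, rfl⟩ := mem_sh.1 hz
        exact lt_trans (code_update_zero_lt hi) (hlt l hl)

end SR

namespace SR
variable {N : ℕ}

/-- the theorem for color set `C` -/
def T (C : Finset (Fin N)) : Prop := ∀ (r : ℕ) (A B : Finset (Fin N → ℕ)),
  (∀ x ∈ A, U C r x) → IsInit C r B → B.card = A.card → (sh B).card ≤ (sh A).card

noncomputable def FI (C : Finset (Fin N)) (r a : ℕ) : ℕ :=
  sInf {s | ∃ B, IsInit C r B ∧ B.card = a ∧ (sh B).card = s}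

theorem FI_eq {C : Finset (Fin N)} {r : ℕ} {B : Finset (Fin N → ℕ)} (hB : IsInit C r B) :
    FI C r B.card = (sh B).card := by
  unfold FI
  have : {s | ∃ D, IsInit C r D ∧ D.card = B.card ∧ (sh D).card = s} = {(sh B).card} := by
    ext s
    simp only [Set.mem_ofPred_eq, Set.mem_singleton_iff]
    constructor
    · rintro ⟨D, hD, hc, rfl⟩
      rw [hD.eq_of_card hB hc]
    · rintro rfl
      exact ⟨B, hB, rfl, rfl⟩
  rw [this, csInf_singleton]

theorem FI_zero (C : Finset (Fin N)) (r : ℕ) : FI C r 0 = 0 := by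
  have := FI_eq (isInit_empty C r)
  simpa [sh] using this

def swp (p p' : Fin N) (x : Fin N → ℕ) : Fin N → ℕ := fun i => x (Equiv.swap p p' i)

theorem swp_swp (p p' : Fin N) (x : Fin N → ℕ) : swp p p' (swp p p' x) = x := by
  funext i; simp [swp]

theorem swp_inj (p p' : Fin N) : Function.Injective (swp p p') := by
  intro x y h
  rw [← swp_swp p p' x, h, swp_swp]

theorem swp_update (p p' i : Fin N) (x : Fin N → ℕ) (m : ℕ) :
    swp p p' (Function.update x i m) = Function.update (swp p p' x) (Equiv.swap p p' i) m := by
  funext j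
  unfold swp
  by_cases h : j = Equiv.swap p p' i
  · subst h; simp
  · rw [Function.update_of_ne h, Function.update_of_ne]
    intro h'
    apply h
    rw [← h']; simp

theorem sh_swp (p p' : Fin N) (A : Finset (Fin N → ℕ)) :
    sh (A.image (swp p p')) = (sh A).image (swp p p') := by
  ext z
  rw [mem_sh, Finset.mem_image]
  constructor
  · rintro ⟨x, hx, i, hi, rfl⟩
    obtain ⟨y, hy, rfl⟩ := Finset.mem_image.1 hx
    refine ⟨Function.update y (Equiv.swap p p' i) 0, mem_sh.2 ⟨y, hy, _, hi, rfl⟩, ?_⟩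
    rw [swp_update]; simp
  · rintro ⟨w, hw, rfl⟩
    obtain ⟨y, hy, i, hi, rfl⟩ := mem_sh.1 hw
    refine ⟨swp p p' y, Finset.mem_image_of_mem _ hy, Equiv.swap p p' i, ?_, ?_⟩
    · simpa [swp] using hi
    · rw [swp_update]

theorem U_swp {C : Finset (Fin N)} {r : ℕ} {p p' : Fin N} (hp : p ∈ C) (hp' : p' ∈ C)
    {x : Fin N → ℕ} (hx : U (C.erase p) r x) : U (C.erase p') r (swp p p' x) := by
  obtain ⟨⟨h1, h2⟩, h3⟩ := U_erase.1 hx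
  have hs : supp (swp p p' x) = (supp x).map (Equiv.swap p p').toEmbedding := by
    ext i
    rw [mem_supp, Finset.mem_map_equiv, mem_supp]
    simp [swp]
  refine U_erase.2 ⟨⟨?_, ?_⟩, ?_⟩
  · rw [hs]
    intro i hi
    rw [Finset.mem_map_equiv] at hi
    have := h1 hi
    by_cases e1 : i = p
    · subst e1; exact hp
    · by_cases e2 : i = p'
      · subst e2; exact hp'
      · rw [Equiv.symm_swap, Equiv.swap_apply_of_ne_of_ne e1 e2] at this
        exact this
  · rw [hs, Finset.card_map, h2]
  · simp [swp, h3]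

theorem FI_swap_aux {C : Finset (Fin N)} {r a : ℕ} {p p' : Fin N} (hp : p ∈ C) (hp' : p' ∈ C)
    {B : Finset (Fin N → ℕ)} (hB : IsInit (C.erase p) r B) (hc : B.card = a)
    (hT : T (C.erase p')) :
    ∃ B', IsInit (C.erase p') r B' ∧ B'.card = a ∧ (sh B').card ≤ (sh B).card := by
  have hA : ∀ x ∈ B.image (swp p p'), U (C.erase p') r x := by
    intro x hx
    obtain ⟨y, hy, rfl⟩ := Finset.mem_image.1 hx
    exact U_swp hp hp' (hB.1 y hy)
  have hcA : (B.image (swp p p')).card = a := by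
    rw [Finset.card_image_of_injective _ (swp_inj p p'), hc]
  obtain ⟨B', hB', hc'⟩ := exists_init hA a hcA.ge
  refine ⟨B', hB', hc', ?_⟩
  have := hT r _ _ hA hB' (by rw [hc', hcA])
  rwa [sh_swp, Finset.card_image_of_injective _ (swp_inj p p')] at this

theorem FI_swap {C : Finset (Fin N)} (r a : ℕ) {p p' : Fin N} (hp : p ∈ C) (hp' : p' ∈ C)
    (hT : ∀ p ∈ C, T (C.erase p)) : FI (C.erase p) r a = FI (C.erase p') r a := by
  by_cases h : ∃ B, IsInit (C.erase p) r B ∧ B.card = a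
  · obtain ⟨B, hB, rfl⟩ := h
    obtain ⟨B', hB', hc', hle⟩ := FI_swap_aux hp hp' hB rfl (hT p' hp')
    obtain ⟨B2, hB2, hc2, hle2⟩ := FI_swap_aux hp' hp hB' hc' (hT p hp)
    have : B2 = B := hB2.eq_of_card hB hc2
    subst this
    rw [FI_eq hB, ← hc', FI_eq hB']
    omega
  · have h' : ¬ ∃ B, IsInit (C.erase p') r B ∧ B.card = a := by
      rintro ⟨B, hB, hc⟩
      obtain ⟨B2, hB2, hc2, _⟩ := FI_swap_aux hp' hp hB hc (hT p hp)
      exact h ⟨B2, hB2, hc2⟩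
    have e : ∀ p, (¬ ∃ B, IsInit (C.erase p) r B ∧ B.card = a) → FI (C.erase p) r a = 0 := by
      intro p h
      unfold FI
      rw [show {s | ∃ B, IsInit (C.erase p) r B ∧ B.card = a ∧ (sh B).card = s} = ∅ from ?_]
      · simp
      · ext s
        simp only [Set.mem_ofPred_eq, Set.mem_empty_iff_false, iff_false]
        rintro ⟨B, hB, hc, _⟩
        exact h ⟨B, hB, hc⟩
    rw [e p h, e p' h']

/-- comparison of sizes of links -/
theorem link_card {C : Finset (Fin N)} {r m : ℕ} {P p : Fin N} (hP : P ∈ C) (hp : p ∈ C)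
    (hm : m ≠ 0) {L : Finset (Fin N → ℕ)} (hL : ∀ l ∈ L, U (C.erase P) r l)
    (hlt : ∀ l ∈ L, code l < 2 ^ vt p m) :
    L.card ≤ (Bel (C.erase p) r (2 ^ vt p m)).card := by
  rw [← Finset.card_image_of_injective L (swp_inj P p)]
  apply Finset.card_le_card
  intro x hx
  obtain ⟨l, hl, rfl⟩ := Finset.mem_image.1 hx
  refine mem_Bel.2 ⟨U_swp hP hp (hL l hl), ?_⟩
  have h0 : l P = 0 := (U_erase.1 (hL l hl)).2
  have h := code_lt_pow.1 (hlt l hl)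
  rw [code_lt_pow]
  intro i hi
  unfold swp at hi ⊢
  by_cases e1 : i = P
  · subst e1
    rw [Equiv.swap_apply_left] at hi ⊢
    have h2 := h p hi
    have h3 : l p < m := by
      by_contra hcon
      have := vt_mono (i := p) (not_lt.1 hcon)
      omega
    exact vt_lt hi h3
  · by_cases e2 : i = p
    · subst e2
      rw [Equiv.swap_apply_right] at hi
      exact absurd h0 hi
    · rw [Equiv.swap_apply_of_ne_of_ne e1 e2] at hi ⊢
      exact h i hi

theorem FI_block {C : Finset (Fin N)} {r m s : ℕ} {p : Fin N} (hp : p ∈ C) (hm : m ≠ 0)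
    (hs : s ≤ (Bel (C.erase p) r (2 ^ vt p m)).card)
    (hpos : 0 < (Bel C (r+1) (2 ^ vt p m)).card + s) :
    FI C (r+1) ((Bel C (r+1) (2 ^ vt p m)).card + s)
      = (Bel C r (2 ^ vt p m)).card + FI (C.erase p) r s := by
  obtain ⟨L, hL, hc⟩ := exists_init (isInit_Bel (C.erase p) r (2 ^ vt p m)).1 s hs
  have hsub := hL.subset_of_card (isInit_Bel (C.erase p) r (2 ^ vt p m)) (by omega)
  have hlt : ∀ l ∈ L, code l < 2 ^ vt p m := fun l hl => (mem_Bel.1 (hsub hl)).2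
  have hL0 : ∀ l ∈ L, l p = 0 := fun l hl => (U_erase.1 (hL.1 l hl)).2
  have hin := init_block hp hm hL hlt
  have hcard : (Bel C (r+1) (2 ^ vt p m) ∪ put L p m).card
      = (Bel C (r+1) (2 ^ vt p m)).card + s := by
    rw [Finset.card_union_of_disjoint (disj_block hm), card_put hL0, hc]
  rw [← hcard, FI_eq hin, sh_block hp hm hL hlt (by rw [← Finset.card_pos]; omega),
    Finset.card_union_of_disjoint (disj_block hm), card_put (sh_zero hL0), ← FI_eq hL, hc]

def Add (C : Finset (Fin N)) (r : ℕ) : Prop := ∀ q s c, s + c ≤ (Bel C r (2^q)).card →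
  FI C r (s+c) ≤ FI C r s + FI C r c ∧
  FI C r (Bel C r (2^q)).card + FI C r s
    ≤ FI C r ((Bel C r (2^q)).card - c) + FI C r (s+c)

/-- indices of vertices of colors in `C` -/
def Pv (C : Finset (Fin N)) (q : ℕ) : Prop := ∃ p ∈ C, ∃ m, m ≠ 0 ∧ vt p m = q

theorem Pv_inf {C : Finset (Fin N)} (hC : C.Nonempty) : (Set.ofPred (Pv C)).Infinite := by
  obtain ⟨p, hp⟩ := hC
  apply Set.infinite_of_injective_forall_mem (f := fun m : ℕ => vt p (m+1))
  · intro a b h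
    have := (vt_inj (by omega) (by omega) h).2
    omega
  · intro m
    exact ⟨p, hp, m+1, by omega, rfl⟩

theorem lt_nth_count {C : Finset (Fin N)} (hC : C.Nonempty) (q a : ℕ) (ha : Pv C a) :
    a < q ↔ a < Nat.nth (Pv C) (Nat.count (Pv C) q) := by
  have hmono := Nat.nth_strictMono (Pv_inf hC)
  constructor
  · intro h
    have h1 := Nat.count_strict_mono ha h
    have h2 := hmono h1
    rwa [Nat.nth_count ha] at h2
  · intro h
    by_contra hcon
    have h1 := Nat.count_monotone (Pv C) (not_lt.1 hcon)
    have h2 := hmono.monotone h1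
    rw [Nat.nth_count ha] at h2
    omega

noncomputable def vj (C : Finset (Fin N)) (j : ℕ) : ℕ := Nat.nth (Pv C) j

theorem vj_spec {C : Finset (Fin N)} (hC : C.Nonempty) (j : ℕ) :
    ∃ p ∈ C, ∃ m, m ≠ 0 ∧ vt p m = vj C j := Nat.nth_mem_of_infinite (Pv_inf hC) j

noncomputable def pj (C : Finset (Fin N)) (hC : C.Nonempty) (j : ℕ) : Fin N :=
  (vj_spec hC j).choose
theorem pj_mem (C : Finset (Fin N)) (hC : C.Nonempty) (j : ℕ) : pj C hC j ∈ C :=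
  (vj_spec hC j).choose_spec.1
noncomputable def mj (C : Finset (Fin N)) (hC : C.Nonempty) (j : ℕ) : ℕ :=
  (vj_spec hC j).choose_spec.2.choose
theorem mj_ne (C : Finset (Fin N)) (hC : C.Nonempty) (j : ℕ) : mj C hC j ≠ 0 :=
  (vj_spec hC j).choose_spec.2.choose_spec.1
theorem vt_pj (C : Finset (Fin N)) (hC : C.Nonempty) (j : ℕ) :
    vt (pj C hC j) (mj C hC j) = vj C j :=
  (vj_spec hC j).choose_spec.2.choose_spec.2

theorem Bel_vj {C : Finset (Fin N)} (hC : C.Nonempty) (r q : ℕ) :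
    Bel C r (2^q) = Bel C r (2 ^ vj C (Nat.count (Pv C) q)) := by
  ext x
  rw [mem_Bel, mem_Bel]
  apply and_congr_right
  intro hx
  rw [code_lt_pow, code_lt_pow]
  apply forall_congr'
  intro i
  apply imp_congr_right
  intro hi
  exact lt_nth_count hC q _ ⟨i, hx.1 (mem_supp.2 hi), _, hi, rfl⟩

theorem Bel_succ {C : Finset (Fin N)} (hC : C.Nonempty) (r j : ℕ) :
    (Bel C (r+1) (2 ^ vj C (j+1))).card = (Bel C (r+1) (2 ^ vj C j)).card
      + (Bel (C.erase (pj C hC j)) r (2 ^ vj C j)).card := by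
  have hmono := Nat.nth_strictMono (Pv_inf hC)
  have hlt : vj C j < vj C (j+1) := hmono (Nat.lt_succ_self j)
  set B := Bel C (r+1) (2 ^ vj C (j+1)) with hB
  set p := pj C hC j
  set m := mj C hC j
  have hp : p ∈ C := pj_mem C hC j
  have hm : m ≠ 0 := mj_ne C hC j
  have hv : vt p m = vj C j := vt_pj C hC j
  rw [← hv] at hlt ⊢
  have hle : 2 ^ (vt p m + 1) ≤ 2 ^ vj C (j+1) := Nat.pow_le_pow_right (by norm_num) hlt
  have hle0 : 2 ^ vt p m ≤ 2 ^ (vt p m + 1) := Nat.pow_le_pow_right (by norm_num) (by omega)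
  have h1 : Bel C (r+1) (2 ^ vt p m) ⊆ B := by
    intro x hx
    rw [hB]
    rw [mem_Bel] at hx ⊢
    exact ⟨hx.1, by omega⟩
  have h2 : ∀ x ∈ B, code x < 2 ^ (vt p m + 1) := by
    intro x hx
    rw [hB, mem_Bel] at hx
    have h := code_lt_pow.1 hx.2
    rw [code_lt_pow]
    intro i hi
    have h3 := h i hi
    have hP : Pv C (vt i (x i)) := ⟨i, hx.1.1 (mem_supp.2 hi), _, hi, rfl⟩
    rw [← Nat.nth_count hP] at h3 ⊢
    have h4 := hmono.lt_iff_lt.1 h3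
    have h5 := hmono.monotone (Nat.lt_succ_iff.1 h4)
    rw [hv]
    exact Nat.lt_succ_iff.2 h5
  have hU : ∀ x ∈ B, U C (r+1) x := fun x hx => (mem_Bel.1 hx).1
  have hsl : sl B p m = Bel (C.erase p) r (2 ^ vt p m) := by
    ext l
    constructor
    · intro hl
      exact mem_Bel.2 ⟨sl_U hU hm l hl, sl_lt hm h2 l hl⟩
    · intro hl
      obtain ⟨hl1, hl2⟩ := mem_Bel.1 hl
      obtain ⟨hl3, hl4⟩ := U_erase.1 hl1
      refine mem_sl.2 ⟨hl4, mem_Bel.2 ⟨U_update_ne hl3 hl4 hp hm, ?_⟩⟩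
      rw [code_update_ne hl4 hm]
      rw [pow_succ] at hle
      omega
  have := block_eq hm hU h1 h2
  rw [hsl] at this
  rw [this, Finset.card_union_of_disjoint (disj_block hm), card_put]
  intro l hl
  exact (U_erase.1 (mem_Bel.1 hl).1).2

noncomputable def f0 (C : Finset (Fin N)) (r : ℕ) (p0 : Fin N) (a : ℕ) : ℕ :=
  if a = 0 then FI C (r+1) 1 - FI (C.erase p0) r 1 else FI C (r+1) a

theorem mkBlk {C : Finset (Fin N)} (hC : C.Nonempty) {r : ℕ} {p0 : Fin N} (hp0 : p0 ∈ C)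
    (hT : ∀ p ∈ C, T (C.erase p)) (hAdd : ∀ p ∈ C, Add (C.erase p) r) :
    Blk (f0 C r p0) (FI (C.erase p0) r) (fun j => (Bel (C.erase (pj C hC j)) r (2 ^ vj C j)).card)
      (fun j => (Bel C (r+1) (2 ^ vj C j)).card) where
  n0 := by
    rw [Finset.card_eq_zero]
    apply Finset.eq_empty_of_forall_notMem
    intro x hx
    obtain ⟨hx1, hx2⟩ := mem_Bel.1 hx
    have hne : (supp x).Nonempty := by rw [← Finset.card_pos, hx1.2]; omega
    obtain ⟨i, hi⟩ := hne
    have h := code_lt_pow.1 hx2 i (mem_supp.1 hi)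
    have hP : Pv C (vt i (x i)) := ⟨i, hx1.1 hi, _, mem_supp.1 hi, rfl⟩
    rw [← Nat.nth_count hP] at h
    have := (Nat.nth_strictMono (Pv_inf hC)).lt_iff_lt.1 h
    omega
  ns := fun j => Bel_succ hC r j
  mono := by
    apply monotone_nat_of_le_succ
    intro j
    have h := (Nat.nth_strictMono (Pv_inf hC)) (Nat.lt_succ_self j)
    rw [← vt_pj C hC (j+1)]
    apply link_card (pj_mem C hC j) (pj_mem C hC (j+1)) (mj_ne C hC (j+1))
    · intro l hl; exact (mem_Bel.1 hl).1
    · intro l hl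
      refine lt_of_lt_of_le (mem_Bel.1 hl).2 ?_
      rw [vt_pj]
      exact Nat.pow_le_pow_right (by norm_num) h.le
  g0 := FI_zero _ _
  fb := by
    intro j s hs
    rw [← vt_pj C hC j] at hs ⊢
    have hp := pj_mem C hC j
    have key := fun s => FI_block (C := C) (r := r) (s := s) hp (mj_ne C hC j)
    have hsw : ∀ a, FI (C.erase (pj C hC j)) r a = FI (C.erase p0) r a :=
      fun a => FI_swap r a hp hp0 hT
    simp only [hsw] at key
    set n := (Bel C (r+1) (2 ^ vt (pj C hC j) (mj C hC j))).card with hn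
    have k0 := key 0 (Nat.zero_le _)
    have ks := key s hs
    rw [FI_zero] at k0
    unfold f0
    by_cases hn0 : n = 0
    · rw [hn0] at ks k0 key ⊢
      by_cases hs0 : s = 0
      · subst hs0; simp [FI_zero]
      · have k1 := key 1 (by omega) (by omega)
        have ks := ks (by omega)
        simp only [zero_add, hs0, if_false, if_true] at *
        omega
    · have k0 := k0 (by omega)
      have ks := ks (by omega)
      rw [if_neg hn0, if_neg (by omega), ks]
      simp only [add_zero] at k0
      rw [k0]
  gsub := by
    intro j s c h
    have := hAdd _ (pj_mem C hC j) (vj C j) s c h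
    simp only [FI_swap r _ (pj_mem C hC j) hp0 hT] at this
    exact this.1
  gfin := by
    intro j s c h
    have := hAdd _ (pj_mem C hC j) (vj C j) s c h
    simp only [FI_swap r _ (pj_mem C hC j) hp0 hT] at this
    exact this.2

theorem add_succ {C : Finset (Fin N)} (hC : C.Nonempty) {r : ℕ}
    (hT : ∀ p ∈ C, T (C.erase p)) (hAdd : ∀ p ∈ C, Add (C.erase p) r) : Add C (r+1) := by
  obtain ⟨p0, hp0⟩ := hC
  have hC : C.Nonempty := ⟨p0, hp0⟩
  have hb := mkBlk hC hp0 hT hAdd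
  intro q s c
  rw [Bel_vj hC]
  set J := Nat.count (Pv C) q
  have h1 := hb.subadd J
  have h2 := hb.fin J
  set n := (Bel C (r+1) (2 ^ vj C J)).card
  have sub : ∀ s c, s + c ≤ n → FI C (r+1) (s+c) ≤ FI C (r+1) s + FI C (r+1) c := by
    intro s c h
    by_cases hs : s = 0
    · subst hs; simp [FI_zero]
    by_cases hc : c = 0
    · subst hc; simp [FI_zero]
    have := h1 s c h
    simp only [f0, hs, hc, if_false, if_true, show ¬ (s + c = 0) by omega] at this
    omega
  intro h
  refine ⟨sub s c h, ?_⟩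
  by_cases hc : c = 0
  · subst hc; simp
  by_cases hs : s = 0
  · subst hs
    have := sub (n - c) c (by omega)
    rw [show n - c + c = n by omega] at this
    simpa [FI_zero] using this
  · have := h2 s c h
    simpa only [f0, hs, hc, if_false, if_true, show ¬ (s + c = 0) by omega,
      show ¬ (n - c = 0) by omega, show ¬ (n = 0) by omega] using this

theorem add_zero' (C : Finset (Fin N)) : Add C 0 := by
  have : ∀ a, FI C 0 a = 0 := by
    intro a
    unfold FI
    rw [Nat.sInf_eq_zero]
    by_cases h : ∃ B, IsInit C 0 B ∧ B.card = a
    · left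
      obtain ⟨B, hB, hc⟩ := h
      refine ⟨B, hB, hc, ?_⟩
      rw [Finset.card_eq_zero]
      apply Finset.eq_empty_of_forall_notMem
      intro z hz
      obtain ⟨x, hx, i, hi, rfl⟩ := mem_sh.1 hz
      have := (hB.1 x hx).2
      rw [Finset.card_eq_zero] at this
      have h2 := mem_supp.2 hi
      rw [this] at h2
      simp at h2
    · right
      ext s
      simp only [Set.mem_ofPred_eq, Set.mem_empty_iff_false, iff_false]
      rintro ⟨B, hB, hc, _⟩
      exact h ⟨B, hB, hc⟩
  intro q s c _
  simp [this]

theorem add_empty (r : ℕ) : Add (∅ : Finset (Fin N)) (r+1) := by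
  intro q s c h
  have : Bel (∅ : Finset (Fin N)) (r+1) (2^q) = ∅ := by
    apply Finset.eq_empty_of_forall_notMem
    intro x hx
    have := (mem_Bel.1 hx).1
    have h1 := Finset.subset_empty.1 this.1
    have h2 := this.2
    rw [h1] at h2
    simp at h2
  rw [this] at h ⊢
  simp at h
  obtain ⟨rfl, rfl⟩ := h
  simp [FI_zero]

theorem cross {C : Finset (Fin N)} {r : ℕ} {p p' : Fin N} {m s l : ℕ} (hp : p ∈ C) (hp' : p' ∈ C)
    (hm : m ≠ 0)
    (hT : ∀ p ∈ C, T (C.erase p)) (hAdd : ∀ p ∈ C, Add (C.erase p) r)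
    (hs : s ≤ (Bel (C.erase p) r (2 ^ vt p m)).card)
    (hl : l ≤ (Bel (C.erase p) r (2 ^ vt p m)).card)
    (hpos : 0 < (Bel C (r+1) (2 ^ vt p m)).card + s) :
    FI C (r+1) ((Bel C (r+1) (2 ^ vt p m)).card + s + l) ≤
      FI C (r+1) ((Bel C (r+1) (2 ^ vt p m)).card + s) + FI (C.erase p') r l := by
  have hC : C.Nonempty := ⟨p, hp⟩
  have hb := mkBlk hC hp' hT hAdd
  have hP : Pv C (vt p m) := ⟨p, hp, m, hm, rfl⟩
  set j := Nat.count (Pv C) (vt p m) with hj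
  have hv : vj C j = vt p m := Nat.nth_count hP
  have hpj : p = pj C hC j := (vt_inj hm (mj_ne C hC j) (by rw [vt_pj, hv])).1
  have := hb.cross j s l
  simp only [hv, ← hpj] at this
  have := this hs hl
  unfold f0 at this
  rwa [if_neg (by omega), if_neg (by omega)] at this

end SR

namespace SR
variable {N : ℕ}

/-- assemble a set from slices -/
noncomputable def asm (S : ℕ → Finset (Fin N → ℕ)) (K : ℕ) (p : Fin N) : Finset (Fin N → ℕ) :=
  (range K).biUnion fun t => put (S t) p t

theorem mem_asm {S : ℕ → Finset (Fin N → ℕ)} {K : ℕ} {p : Fin N} (h0 : ∀ t, ∀ l ∈ S t, l p = 0)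
    {x : Fin N → ℕ} : x ∈ asm S K p ↔ x p < K ∧ Function.update x p 0 ∈ S (x p) := by
  unfold asm
  simp only [Finset.mem_biUnion, Finset.mem_range, mem_put]
  constructor
  · rintro ⟨t, ht, l, hl, rfl⟩
    simp only [Function.update_self]
    rw [update_update_zero (h0 t l hl)]
    exact ⟨ht, hl⟩
  · rintro ⟨h1, h2⟩
    exact ⟨x p, h1, _, h2, update_zero_update⟩

theorem asm_disj (S : ℕ → Finset (Fin N → ℕ)) (K : ℕ) (p : Fin N) :
    (↑(range K) : Set ℕ).PairwiseDisjoint fun t => put (S t) p t := by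
  intro t _ u _ htu
  simp only [Function.onFun]
  rw [Finset.disjoint_left]
  intro x hx hx'
  obtain ⟨l, _, rfl⟩ := mem_put.1 hx
  obtain ⟨l', _, h⟩ := mem_put.1 hx'
  have := congrFun h p
  simp only [Function.update_self] at this
  exact htu this.symm

theorem card_asm {S : ℕ → Finset (Fin N → ℕ)} {K : ℕ} {p : Fin N} (h0 : ∀ t, ∀ l ∈ S t, l p = 0) :
    (asm S K p).card = ∑ t ∈ range K, (S t).card := by
  unfold asm
  rw [Finset.card_biUnion (asm_disj S K p)]
  exact Finset.sum_congr rfl fun t _ => card_put (h0 t)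

theorem sum_put {L : Finset (Fin N → ℕ)} {p : Fin N} {m : ℕ} (h : ∀ l ∈ L, l p = 0) :
    ∑ x ∈ put L p m, code x = L.card * (if m = 0 then 0 else 2 ^ vt p m) + ∑ l ∈ L, code l := by
  unfold put
  rw [Finset.sum_image]
  · rw [← smul_eq_mul, ← Finset.sum_const, ← Finset.sum_add_distrib]
    apply Finset.sum_congr rfl
    intro l hl
    by_cases hm : m = 0
    · subst hm
      rw [show Function.update l p 0 = l by rw [← h l hl, Function.update_eq_self]]
      simp
    · rw [if_neg hm, code_update_ne (h l hl) hm]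
  · intro x hx y hy hxy
    simp only at hxy
    rw [← update_update_zero (m := m) (h x hx), hxy, update_update_zero (h y hy)]

theorem sum_asm {S : ℕ → Finset (Fin N → ℕ)} {K : ℕ} {p : Fin N} (h0 : ∀ t, ∀ l ∈ S t, l p = 0) :
    ∑ x ∈ asm S K p, code x
      = ∑ t ∈ range K, ((S t).card * (if t = 0 then 0 else 2 ^ vt p t) + ∑ l ∈ S t, code l) := by
  unfold asm
  rw [Finset.sum_biUnion (asm_disj S K p)]
  exact Finset.sum_congr rfl fun t _ => sum_put (h0 t)

noncomputable def shS (S : ℕ → Finset (Fin N → ℕ)) (K : ℕ) (t : ℕ) : Finset (Fin N → ℕ) :=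
  if t = 0 then sh (S 0) ∪ (Ico 1 K).biUnion S else sh (S t)

theorem shS_zero {S : ℕ → Finset (Fin N → ℕ)} {K : ℕ} {p : Fin N}
    (h0 : ∀ t, ∀ l ∈ S t, l p = 0) : ∀ t, ∀ l ∈ shS S K t, l p = 0 := by
  intro t l hl
  unfold shS at hl
  split_ifs at hl with h
  · rcases Finset.mem_union.1 hl with h | h
    · exact sh_zero (h0 0) l h
    · obtain ⟨t, _, ht⟩ := Finset.mem_biUnion.1 h
      exact h0 t l ht
  · exact sh_zero (h0 t) l hl

theorem sh_asm {S : ℕ → Finset (Fin N → ℕ)} {K : ℕ} {p : Fin N} (hK : 0 < K)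
    (h0 : ∀ t, ∀ l ∈ S t, l p = 0) : sh (asm S K p) = asm (shS S K) K p := by
  ext z
  rw [mem_asm (shS_zero h0), mem_sh]
  constructor
  · rintro ⟨x, hx, i, hi, rfl⟩
    obtain ⟨h1, h2⟩ := (mem_asm h0).1 hx
    by_cases hip : i = p
    · subst hip
      simp only [Function.update_self, Function.update_idem]
      refine ⟨hK, ?_⟩
      unfold shS
      rw [if_pos rfl]
      refine Finset.mem_union_right _ (Finset.mem_biUnion.2 ⟨x i, ?_, h2⟩)
      rw [Finset.mem_Ico]; omega
    · have hpi : p ≠ i := fun h => hip h.symm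
      rw [Function.update_of_ne hpi, Function.update_comm hip]
      refine ⟨h1, ?_⟩
      have : Function.update (Function.update x p 0) i 0 ∈ sh (S (x p)) :=
        mem_sh.2 ⟨_, h2, i, by rwa [Function.update_of_ne hip], rfl⟩
      unfold shS
      split_ifs with h
      · rw [h] at this
        exact Finset.mem_union_left _ this
      · exact this
  · rintro ⟨h1, h2⟩
    have key : Function.update z p 0 ∈ sh (S (z p)) →
        ∃ x ∈ asm S K p, ∃ i, x i ≠ 0 ∧ Function.update x i 0 = z := by
      intro h
      obtain ⟨l, hl, i, hi, he⟩ := mem_sh.1 h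
      have hlp := h0 _ l hl
      have hip : i ≠ p := by rintro rfl; exact hi hlp
      refine ⟨Function.update l p (z p), (mem_asm h0).2 ?_, i,
        by rwa [Function.update_of_ne hip], ?_⟩
      · simp only [Function.update_self]
        rw [update_update_zero hlp]
        exact ⟨h1, hl⟩
      · rw [Function.update_comm hip.symm, he, update_zero_update]
    unfold shS at h2
    split_ifs at h2 with hz
    · rcases Finset.mem_union.1 h2 with h | h
      · exact key (by rw [hz]; exact h)
      · obtain ⟨t, ht, h⟩ := Finset.mem_biUnion.1 h
        rw [Finset.mem_Ico] at ht
        refine ⟨Function.update z p t, (mem_asm h0).2 ?_, p, by simp; omega, ?_⟩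
        · simp only [Function.update_self, Function.update_idem]
          exact ⟨ht.2, h⟩
        · exact update_update_zero hz
    · exact key h2

theorem asm_sl {A : Finset (Fin N → ℕ)} {p : Fin N} {K : ℕ} (hK : ∀ x ∈ A, x p < K) :
    asm (sl A p) K p = A := by
  ext x
  rw [mem_asm (fun t l hl => (mem_sl.1 hl).1), mem_sl, update_zero_update]
  constructor
  · exact fun h => h.2.2
  · exact fun h => ⟨hK x h, by simp, h⟩

theorem biUnion_init {C : Finset (Fin N)} {r M : ℕ} {S : ℕ → Finset (Fin N → ℕ)}
    {D : Finset (Fin N → ℕ)} (hD : IsInit C r D) (hDM : D.card ≤ M) (s : Finset ℕ)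
    (h : ∀ t ∈ s, IsInit C r (S t)) (hM : ∀ t ∈ s, (S t).card ≤ M) :
    IsInit C r (D ∪ s.biUnion S) ∧ (D ∪ s.biUnion S).card ≤ M := by
  induction s using Finset.induction_on with
  | empty => simpa using ⟨hD, hDM⟩
  | insert a s ha ih =>
    obtain ⟨h1, h2⟩ := ih (fun t ht => h t (Finset.mem_insert_of_mem ht))
      (fun t ht => hM t (Finset.mem_insert_of_mem ht))
    have e : D ∪ (insert a s).biUnion S = (D ∪ s.biUnion S) ∪ S a := by
      rw [Finset.biUnion_insert, Finset.union_assoc, Finset.union_comm (S a)]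
    rw [e]
    have h3 := h a (Finset.mem_insert_self _ _)
    rcases h1.subset_or h3 with h4 | h4
    · rw [Finset.union_eq_right.2 h4]
      exact ⟨h3, hM a (Finset.mem_insert_self _ _)⟩
    · rw [Finset.union_eq_left.2 h4]
      exact ⟨h1, h2⟩

theorem compression {C : Finset (Fin N)} {r : ℕ} {p : Fin N} (hp : p ∈ C) (hT : T (C.erase p))
    {A : Finset (Fin N → ℕ)} (hA : ∀ x ∈ A, U C (r+1) x) {x y : Fin N → ℕ} (hy : y ∈ A)
    (hxU : U C (r+1) x) (hx : x ∉ A) (hxy : code x < code y) (hxp : x p = y p) :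
    ∃ A' : Finset (Fin N → ℕ), (∀ x ∈ A', U C (r+1) x) ∧ A'.card = A.card ∧
      ∑ x ∈ A', code x < ∑ x ∈ A, code x ∧ (sh A').card ≤ (sh A).card := by
  set K := A.sup (fun x => x p) + 1 with hKdef
  have hK : ∀ x ∈ A, x p < K := by
    intro x hx
    have := Finset.le_sup (f := fun x : Fin N → ℕ => x p) hx
    omega
  set rk : ℕ → ℕ := fun t => if t = 0 then r + 1 else r with hrk
  have hSU : ∀ t, ∀ l ∈ sl A p t, U (C.erase p) (rk t) l := by
    intro t
    by_cases ht : t = 0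
    · subst ht; simpa [hrk] using sl_U_zero hA
    · simpa [hrk, ht] using sl_U hA ht
  have hJ := fun t => exists_init (hSU t) _ le_rfl
  choose J hJi hJc using hJ
  have hJ0 : ∀ t, ∀ l ∈ J t, l p = 0 := fun t l hl => (U_erase.1 ((hJi t).1 l hl)).2
  have hS0 : ∀ t, ∀ l ∈ sl A p t, l p = 0 := fun t l hl => (mem_sl.1 hl).1
  have hAe := asm_sl hK
  refine ⟨asm J K p, ?_, ?_, ?_, ?_⟩
  · intro z hz
    obtain ⟨h1, h2⟩ := (mem_asm hJ0).1 hz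
    have h3 := (hJi _).1 _ h2
    by_cases hzp : z p = 0
    · rw [hzp] at h3
      rw [show Function.update z p 0 = z by rw [← hzp, Function.update_eq_self]] at h3
      exact (U_erase.1 (by simpa [hrk] using h3)).1
    · have h4 : U (C.erase p) r (Function.update z p 0) := by simpa [hrk, hzp] using h3
      have := U_update_ne (U_erase.1 h4).1 (by simp) hp hzp
      rwa [update_zero_update] at this
  · conv_rhs => rw [← hAe]
    rw [card_asm hJ0, card_asm hS0]
    exact Finset.sum_congr rfl fun t _ => hJc t
  · conv_rhs => rw [← hAe]
    rw [sum_asm hJ0, sum_asm hS0]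
    apply Finset.sum_lt_sum
    · intro t _
      rw [hJc t]
      have := sum_code_le (hSU t) (hJi t) (hJc t)
      omega
    · refine ⟨y p, Finset.mem_range.2 (hK y hy), ?_⟩
      rw [hJc]
      have : J (y p) ≠ sl A p (y p) := by
        intro he
        have h1 : Function.update y p 0 ∈ J (y p) := by
          rw [he, mem_sl, update_zero_update]; exact ⟨by simp, hy⟩
        have h2 : Function.update x p 0 ∈ J (y p) := by
          refine (hJi _).2 _ h1 _ ?_ ?_
          · by_cases h : y p = 0
            · rw [h]
              rw [show Function.update x p 0 = x by rw [← h, ← hxp, Function.update_eq_self]]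
              simpa [hrk] using U_erase.2 ⟨hxU, by omega⟩
            · simpa [hrk, h] using U_update_zero hxU (by omega)
          · rw [← code_update_le_iff (p := p) (m := y p) (by simp) (by simp), update_zero_update,
              ← hxp, update_zero_update]
            exact hxy.le
        rw [he, mem_sl, ← hxp, update_zero_update] at h2
        exact hx h2.2
      have := sum_code_lt (hSU _) (hJi _) (hJc _) this
      omega
  · conv_rhs => rw [← hAe]
    rw [sh_asm (by omega) hJ0, sh_asm (by omega) hS0, card_asm (shS_zero hJ0),
      card_asm (shS_zero hS0)]
    apply Finset.sum_le_sum
    intro t _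
    have hTt : ∀ t, (sh (J t)).card ≤ (sh (sl A p t)).card := fun t =>
      hT _ _ _ (hSU t) (hJi t) (hJc t)
    unfold shS
    split_ifs with ht
    · refine (biUnion_init (C := C.erase p) (r := r) (isInit_sh _ _ rfl r (J 0) ?_) ?_ _ ?_ ?_).2
      · simpa [hrk] using hJi 0
      · exact (hTt 0).trans (Finset.card_le_card Finset.subset_union_left)
      · intro t ht
        rw [Finset.mem_Ico] at ht
        have := hJi t
        simpa [hrk, show t ≠ 0 by omega] using this
      · intro t ht
        rw [hJc]
        apply Finset.card_le_card
        exact (Finset.subset_biUnion_of_mem (sl A p) ht).trans Finset.subset_union_right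
    · exact hTt t

end SR

namespace SR
variable {N : ℕ}

theorem swap_step {C : Finset (Fin N)} {r : ℕ}
    {A : Finset (Fin N → ℕ)} (hA : ∀ x ∈ A, U C r x) {x y : Fin N → ℕ} (hy : y ∈ A)
    (hxU : U C r x) (hx : x ∉ A) (hxy : code x < code y) (hsh : sh {x} ⊆ sh A) :
    ∃ A' : Finset (Fin N → ℕ), (∀ x ∈ A', U C r x) ∧ A'.card = A.card ∧
      ∑ x ∈ A', code x < ∑ x ∈ A, code x ∧ (sh A').card ≤ (sh A).card := by
  have hxe : x ∉ A.erase y := fun h => hx (Finset.mem_of_mem_erase h)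
  refine ⟨insert x (A.erase y), ?_, ?_, ?_, ?_⟩
  · intro z hz
    rcases Finset.mem_insert.1 hz with rfl | hz
    · exact hxU
    · exact hA z (Finset.mem_of_mem_erase hz)
  · rw [Finset.card_insert_of_notMem hxe, Finset.card_erase_add_one hy]
  · rw [Finset.sum_insert hxe, ← Finset.add_sum_erase A code hy]
    omega
  · apply Finset.card_le_card
    rw [Finset.insert_eq, sh_union]
    exact Finset.union_subset hsh (sh_mono (Finset.erase_subset _ _))

theorem card_sh_single (y : Fin N → ℕ) : (sh {y}).card = (supp y).card := by
  unfold sh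
  rw [Finset.singleton_biUnion]
  apply Finset.card_image_of_injOn
  intro i hi j hj h
  by_contra hij
  have := congrFun h i
  simp only [Function.update_self] at this
  rw [Function.update_of_ne hij] at this
  exact mem_supp.1 hi this.symm

theorem sh_rank_zero {C : Finset (Fin N)} {B : Finset (Fin N → ℕ)} (hB : ∀ x ∈ B, U C 0 x) :
    sh B = ∅ := by
  apply Finset.eq_empty_of_forall_notMem
  intro z hz
  obtain ⟨x, hx, i, hi, rfl⟩ := mem_sh.1 hz
  have := (hB x hx).2
  rw [Finset.card_eq_zero] at this
  have h2 := mem_supp.2 hi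
  rw [this] at h2
  simp at h2

theorem T_one {C : Finset (Fin N)} {A B : Finset (Fin N → ℕ)}
    (hA : ∀ x ∈ A, U C 1 x) (hB : ∀ x ∈ B, U C 1 x) (hc : B.card = A.card) :
    (sh B).card ≤ (sh A).card := by
  rcases A.eq_empty_or_nonempty with rfl | ⟨y, hy⟩
  · rw [Finset.card_empty, Finset.card_eq_zero] at hc
    rw [hc]
  · have h1 : 1 ≤ (sh A).card := by
      rw [← (hA y hy).2, ← card_sh_single]
      exact Finset.card_le_card (sh_mono (by simpa using hy))
    have h2 : sh B ⊆ {fun _ => 0} := by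
      intro z hz
      have := (sh_U (r := 0) hB z hz).2
      rw [Finset.card_eq_zero] at this
      rw [Finset.mem_singleton]
      funext i
      by_contra h
      have h3 := mem_supp.2 h
      rw [this] at h3
      simp at h3
    exact (Finset.card_le_card h2).trans (by simpa using h1)

/-- splitting at the top vertex -/
theorem split_le {A : Finset (Fin N → ℕ)} {P : Fin N} {M : ℕ} (hM : M ≠ 0) :
    (sh (A.filter fun x => x P ≠ M)).card + (sh (sl A P M)).card ≤ (sh A).card := by
  have hL0 : ∀ l ∈ sl A P M, l P = 0 := fun l hl => (mem_sl.1 hl).1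
  rw [← card_put (m := M) (sh_zero hL0), ← Finset.card_union_of_disjoint]
  · apply Finset.card_le_card
    apply Finset.union_subset
    · exact sh_mono (Finset.filter_subset _ _)
    · have : put (sh (sl A P M)) P M ⊆ sh (put (sl A P M) P M) := by
        rw [sh_put_of hM hL0]; exact Finset.subset_union_right
      refine this.trans (sh_mono ?_)
      rw [put_sl]
      exact Finset.filter_subset _ _
  · rw [Finset.disjoint_left]
    intro z hz hz'
    obtain ⟨x, hx, i, hi, rfl⟩ := mem_sh.1 hz
    obtain ⟨l, _, he⟩ := mem_put.1 hz'
    have := congrFun he P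
    rw [Function.update_self] at this
    by_cases hPi : P = i
    · subst hPi
      rw [Function.update_self] at this
      exact hM this
    · rw [Function.update_of_ne hPi] at this
      exact (Finset.mem_filter.1 hx).2 this.symm

/-- case: the part below the top vertex is an initial segment -/
theorem case_init {C : Finset (Fin N)} {r : ℕ} (hT : ∀ p ∈ C, T (C.erase p))
    (hAdd : ∀ p ∈ C, Add (C.erase p) (r+1))
    {A B : Finset (Fin N → ℕ)} (hA : ∀ x ∈ A, U C (r+2) x) (hB : IsInit C (r+2) B)
    (hc : B.card = A.card) (hnot : ¬ IsInit C (r+2) A)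
    (hC : ∀ p ∈ C, ∀ y ∈ A, ∀ x, U C (r+2) x → x ∉ A → code x < code y → x p ≠ y p)
    {P : Fin N} {M : ℕ} (hP : P ∈ C) (hM : M ≠ 0)
    (hlt : ∀ x ∈ A, code x < 2 ^ (vt P M + 1))
    (hLne : (sl A P M).Nonempty)
    (hin : IsInit C (r+2) (A.filter fun x => x P ≠ M))
    (hcard : A.card = (A.filter fun x => x P ≠ M).card + (sl A P M).card) :
    (sh B).card ≤ (sh A).card := by
  set A' := A.filter fun x => x P ≠ M with hA'
  set L := sl A P M with hL
  have hspl := split_le (A := A) (P := P) hM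
  rw [← hA', ← hL] at hspl
  have hLU : ∀ l ∈ L, U (C.erase P) (r+1) l := sl_U hA hM
  have hLA : ∀ l ∈ L, l P = 0 ∧ Function.update l P M ∈ A := fun l hl => mem_sl.1 hl
  have hLlt : ∀ l ∈ L, code l < 2 ^ vt P M := sl_lt hM hlt
  -- minimal missing element
  have hex : ∃ c, ∃ x, U C (r+2) x ∧ x ∉ A ∧ code x = c := by
    by_contra hcon
    push Not at hcon
    apply hnot
    refine ⟨hA, fun y hy x hx _ => ?_⟩
    by_contra hxA
    exact hcon _ x hx hxA rfl
  obtain ⟨x, hxU, hxA, hxc⟩ := Nat.find_spec hex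
  have hmin : ∀ x', U C (r+2) x' → code x' < code x → x' ∈ A := by
    intro x' hx' hlt'
    by_contra hx'A
    rw [hxc] at hlt'
    exact Nat.find_min hex hlt' ⟨x', hx', hx'A, rfl⟩
  have hyx : ∃ y ∈ A, code x < code y := by
    by_contra hcon
    push Not at hcon
    apply hnot
    refine ⟨hA, fun y hy x' hx' hle => ?_⟩
    rcases Nat.lt_or_ge (code x') (code x) with h | h
    · exact hmin x' hx' h
    · have : code x' = code y := by have := hcon y hy; omega
      rw [code_inj this]; exact hy
  have hxlt : code x < 2 ^ vt P M := by
    by_contra hcon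
    obtain ⟨y, hy, hxy⟩ := hyx
    have h1 := not_lt.1 hcon
    obtain ⟨i, hi, hv⟩ := top_vertex h1 (hxy.trans (hlt y hy))
    obtain ⟨rfl, h2⟩ := vt_inj hi hM hv
    obtain ⟨j, hj, hv'⟩ := top_vertex (h1.trans hxy.le) (hlt y hy)
    obtain ⟨rfl, h3⟩ := vt_inj hj hM hv'
    exact hC j hP y hy x hxU hxA hxy (by omega)
  have hA'x : ∀ a ∈ A', code a < code x := by
    intro a ha
    by_contra hcon
    have := hin.2 a ha x hxU (not_lt.1 hcon)
    exact hxA (Finset.mem_filter.1 this).1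
  have hxA' : ∀ x', U C (r+2) x' → code x' < code x → x' ∈ A' := by
    intro x' hx' hlt'
    refine Finset.mem_filter.2 ⟨hmin x' hx' hlt', fun h => ?_⟩
    have := pow_le_code hM h
    omega
  obtain ⟨p, hxp, hv1, hv2⟩ := exists_top (x := x) (by rw [← Finset.card_pos, hxU.2]; omega)
  have hpC : p ∈ C := hxU.1 (mem_supp.2 hxp)
  set m := x p with hm
  have hb1 : Bel C (r+2) (2 ^ vt p m) ⊆ A' := by
    intro z hz
    obtain ⟨hz1, hz2⟩ := mem_Bel.1 hz
    exact hxA' z hz1 (by omega)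
  have hb2 : ∀ z ∈ A', code z < 2 ^ (vt p m + 1) := fun z hz => (hA'x z hz).trans hv2
  have hA'U : ∀ z ∈ A', U C (r+2) z := hin.1
  have hbe := block_eq hxp hA'U hb1 hb2
  have hL'0 : ∀ l ∈ sl A' p m, l p = 0 := fun l hl => (mem_sl.1 hl).1
  have hA'c : A'.card = (Bel C (r+2) (2 ^ vt p m)).card + (sl A' p m).card := by
    conv_lhs => rw [hbe]
    rw [Finset.card_union_of_disjoint (disj_block hxp), card_put hL'0]
  have hs : (sl A' p m).card ≤ (Bel (C.erase p) (r+1) (2 ^ vt p m)).card := by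
    apply Finset.card_le_card
    intro l hl
    exact mem_Bel.2 ⟨sl_U hA'U hxp l hl, sl_lt hxp hb2 l hl⟩
  have hLx : ∀ l ∈ L, ∀ i ∈ C, x i ≠ Function.update l P M i := by
    intro l hl i hi
    obtain ⟨h1, h2⟩ := hLA l hl
    refine hC i hi _ h2 x hxU hxA ?_
    rw [code_update_ne h1 hM]
    omega
  -- size of the link
  have hsize : L.card ≤ (Bel (C.erase p) (r+1) (2 ^ vt p m)).card ∧
      (A'.card = 0 → L.card ≤ 1) := by
    by_cases hM1 : M = 1
    · subst hM1
      have hL1 : L.card ≤ 1 := by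
        rw [Finset.card_le_one]
        have key : ∀ l ∈ L, ∀ i ∈ C, i ≠ P → l i = 1 - x i := by
          intro l hl i hi hiP
          have h1 := hLx l hl i hi
          rw [Function.update_of_ne hiP] at h1
          have h2 : x i ≤ 1 := by
            by_cases h : x i = 0
            · omega
            · exact vt_le_val one_ne_zero (code_lt_pow.1 hxlt i h).le
          have h3 : l i ≤ 1 := by
            by_cases h : l i = 0
            · omega
            · exact vt_le_val one_ne_zero (code_lt_pow.1 (hLlt l hl) i h).le
          omega
        intro l hl l' hl'
        funext i
        by_cases hi : i ∈ C
        · by_cases hiP : i = P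
          · subst hiP
            rw [(hLA l hl).1, (hLA l' hl').1]
          · rw [key l hl i hi hiP, key l' hl' i hi hiP]
        · have e : ∀ l ∈ L, l i = 0 := by
            intro l hl
            by_contra h
            exact hi (Finset.mem_of_mem_erase ((hLU l hl).1 (mem_supp.2 h)))
          rw [e l hl, e l' hl']
      refine ⟨hL1.trans ?_, fun _ => hL1⟩
      rw [Nat.succ_le_iff, Finset.card_pos]
      refine ⟨Function.update x p 0, mem_Bel.2 ⟨U_update_zero hxU hxp, ?_⟩⟩
      have := code_update_zero hxp
      rw [← hm] at this
      rw [pow_succ] at hv2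
      omega
    · have hz : ∀ l ∈ L, Function.update l P (M-1) ∈ A' := by
        intro l hl
        obtain ⟨h1, h2⟩ := hLA l hl
        have hM' : M - 1 ≠ 0 := by omega
        have hzU : U C (r+2) (Function.update l P (M-1)) :=
          U_update_ne (U_erase.1 (hLU l hl)).1 h1 hP hM'
        refine Finset.mem_filter.2 ⟨?_, by rw [Function.update_self]; omega⟩
        by_contra hzA
        have hne : (supp l).Nonempty := by rw [← Finset.card_pos, (hLU l hl).2]; omega
        obtain ⟨i, hi⟩ := hne
        have hiC := (hLU l hl).1 hi
        rw [Finset.mem_erase] at hiC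
        refine hC i hiC.2 _ h2 _ hzU hzA ?_ ?_
        · rw [code_update_ne h1 hM', code_update_ne h1 hM]
          have := vt_lt (i := P) (j := P) hM' (show M - 1 < M by omega)
          have := Nat.pow_lt_pow_right (a := 2) (by norm_num) this
          omega
        · rw [Function.update_of_ne hiC.1, Function.update_of_ne hiC.1]
      constructor
      · apply link_card hP hpC hxp hLU
        intro l hl
        by_contra hcon
        obtain ⟨h1, h2⟩ := hLA l hl
        have h3 := hb2 _ (hz l hl)
        rw [code_update_ne h1 (by omega)] at h3
        have h5 : 0 < 2 ^ vt P (M-1) := by positivity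
        obtain ⟨i, hi, hv⟩ := top_vertex (not_lt.1 hcon) (by omega)
        obtain ⟨rfl, h4⟩ := vt_inj hi hxp hv
        have hiP : i ≠ P := by rintro rfl; exact hi h1
        apply hLx l hl i hpC
        rw [Function.update_of_ne hiP, h4]
      · intro h0
        obtain ⟨l, hl⟩ := hLne
        rw [Finset.card_eq_zero] at h0
        have := hz l hl
        rw [h0] at this
        simp at this
  by_cases h0 : A'.card = 0
  · have hA1 : A.card = 1 := by
      have := hsize.2 h0
      have := Finset.card_pos.2 hLne
      omega
    obtain ⟨a, rfl⟩ := Finset.card_eq_one.1 hA1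
    obtain ⟨b, rfl⟩ := Finset.card_eq_one.1 (hc.trans hA1)
    rw [card_sh_single, card_sh_single, (hA a (by simp)).2, (hB.1 b (by simp)).2]
  · have hcr : FI C (r+2) ((Bel C (r+2) (2 ^ vt p m)).card + (sl A' p m).card + L.card) ≤
        FI C (r+2) ((Bel C (r+2) (2 ^ vt p m)).card + (sl A' p m).card)
          + FI (C.erase P) (r+1) L.card :=
      cross (p' := P) hpC hP hxp hT hAdd hs hsize.1
        (show 0 < (Bel C (r+2) (2 ^ vt p m)).card + (sl A' p m).card by omega)
    rw [← hA'c, ← hcard, ← hc, FI_eq hB, FI_eq hin] at hcr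
    obtain ⟨D, hD, hDc⟩ := exists_init hLU _ le_rfl
    have h2 := hT P hP _ _ _ hLU hD hDc
    rw [← FI_eq hD, hDc] at h2
    omega

theorem T_two {C : Finset (Fin N)} {r : ℕ} (hT : ∀ p ∈ C, T (C.erase p))
    (hAdd : ∀ p ∈ C, Add (C.erase p) (r+1)) : ∀ (S : ℕ)
    (A B : Finset (Fin N → ℕ)), ∑ x ∈ A, code x = S → (∀ x ∈ A, U C (r+2) x) →
    IsInit C (r+2) B → B.card = A.card → (sh B).card ≤ (sh A).card := by
  intro S
  induction S using Nat.strong_induction_on with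
  | _ S ih =>
  intro A B hS hA hB hc
  subst hS
  by_cases hnot : IsInit C (r+2) A
  · rw [hB.eq_of_card hnot hc]
  have hred : (∃ A' : Finset (Fin N → ℕ), (∀ x ∈ A', U C (r+2) x) ∧ A'.card = A.card ∧
      ∑ x ∈ A', code x < ∑ x ∈ A, code x ∧ (sh A').card ≤ (sh A).card) →
      (sh B).card ≤ (sh A).card := by
    rintro ⟨A', h1, h2, h3, h4⟩
    exact (ih _ h3 A' B rfl h1 hB (by omega)).trans h4
  by_cases hC : ∀ p ∈ C, ∀ y ∈ A, ∀ x, U C (r+2) x → x ∉ A → code x < code y → x p ≠ y p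
  swap
  · push Not at hC
    obtain ⟨p, hp, y, hy, x, hx1, hx2, hx3, hx4⟩ := hC
    exact hred (compression hp (hT p hp) hA hy hx1 hx2 hx3 hx4)
  have hne : A.Nonempty := by
    rw [Finset.nonempty_iff_ne_empty]
    rintro rfl
    exact hnot (isInit_empty _ _)
  obtain ⟨y, hy, hmax⟩ := Finset.exists_max_image A code hne
  obtain ⟨P, hPM, hv1, hv2⟩ := exists_top (x := y)
    (by rw [← Finset.card_pos, (hA y hy).2]; omega)
  have hP : P ∈ C := (hA y hy).1 (mem_supp.2 hPM)
  set M := y P with hM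
  have hlt : ∀ x ∈ A, code x < 2 ^ (vt P M + 1) := by
    intro x hx
    have := hmax x hx
    omega
  set A' := A.filter fun x => x P ≠ M with hA'
  set L := sl A P M with hL
  have hyL : Function.update y P 0 ∈ L :=
    mem_sl.2 ⟨by simp, by rw [hM, update_zero_update]; exact hy⟩
  have hLne : L.Nonempty := ⟨_, hyL⟩
  have hLA : ∀ l ∈ L, l P = 0 ∧ Function.update l P M ∈ A := fun l hl => mem_sl.1 hl
  have hL0 : ∀ l ∈ L, l P = 0 := fun l hl => (hLA l hl).1
  have hLU : ∀ l ∈ L, U (C.erase P) (r+1) l := sl_U hA hPM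
  have hcard : A.card = A'.card + L.card := by
    rw [← card_put (m := M) hL0, put_sl, add_comm]
    exact (Finset.card_filter_add_card_filter_not (s := A) (fun x => x P = M)).symm
  by_cases hin : IsInit C (r+2) A'
  · exact case_init hT hAdd hA hB hc hnot hC hP hPM hlt hLne hin hcard
  have hsum : ∑ x ∈ A, code x = ∑ x ∈ put L P M, code x + ∑ x ∈ A', code x := by
    rw [put_sl]
    exact (Finset.sum_filter_add_sum_filter_not A (fun x => x P = M) code).symm
  have hyput : y ∈ put L P M := by
    rw [put_sl]; exact Finset.mem_filter.2 ⟨hy, rfl⟩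
  have hpos : 0 < ∑ x ∈ put L P M, code x := by
    have h1 : code y ≤ ∑ x ∈ put L P M, code x :=
      Finset.single_le_sum (f := code) (fun _ _ => Nat.zero_le _) hyput
    have h2 : 0 < 2 ^ vt P M := by positivity
    omega
  have hspl := split_le (A := A) (P := P) hPM
  rw [← hA', ← hL] at hspl
  have hA'U : ∀ x ∈ A', U C (r+2) x := fun x hx => hA x (Finset.mem_filter.1 hx).1
  have hA'Bel : A' ⊆ Bel C (r+2) (2 ^ vt P M) := by
    intro x hx
    obtain ⟨h1, h2⟩ := Finset.mem_filter.1 hx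
    refine mem_Bel.2 ⟨hA x h1, ?_⟩
    by_contra hcon
    obtain ⟨i, hi, hv⟩ := top_vertex (not_lt.1 hcon) (hlt x h1)
    obtain ⟨rfl, h3⟩ := vt_inj hi hPM hv
    exact h2 h3
  obtain ⟨B', hB', hB'c⟩ := exists_init hA'U _ le_rfl
  have hB'ne : B' ≠ A' := by rintro rfl; exact hin hB'
  have hsB' := sum_code_lt hA'U hB' hB'c hB'ne
  have hshB' : (sh B').card ≤ (sh A').card := ih _ (by omega) A' B' rfl hA'U hB' hB'c
  have hB'Bel : B' ⊆ Bel C (r+2) (2 ^ vt P M) :=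
    hB'.subset_of_card (isInit_Bel _ _ _) (by rw [hB'c]; exact Finset.card_le_card hA'Bel)
  by_cases hsub : L ⊆ sh B'
  · apply hred
    have hdis : Disjoint B' (put L P M) := Finset.disjoint_of_subset_left hB'Bel (disj_block hPM)
    refine ⟨B' ∪ put L P M, ?_, ?_, ?_, ?_⟩
    · intro x hx
      rcases Finset.mem_union.1 hx with h | h
      · exact hB'.1 x h
      · rw [put_sl] at h
        exact hA x (Finset.mem_filter.1 h).1
    · rw [Finset.card_union_of_disjoint hdis, card_put hL0]
      omega
    · rw [Finset.sum_union hdis]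
      omega
    · have : sh (B' ∪ put L P M) ⊆ sh B' ∪ put (sh L) P M := by
        rw [sh_union, sh_put_of hPM hL0]
        exact Finset.union_subset Finset.subset_union_left
          (Finset.union_subset (hsub.trans Finset.subset_union_left) Finset.subset_union_right)
      have h1 := Finset.card_le_card this
      have h2 := Finset.card_union_le (sh B') (put (sh L) P M)
      rw [card_put (sh_zero hL0)] at h2
      omega
  · obtain ⟨l, hl, hlB⟩ := Finset.not_subset.1 hsub
    obtain ⟨hl0, hlM⟩ := hLA l hl
    have hlU := (U_erase.1 (hLU l hl)).1
    have hne' : (supp l).Nonempty := by rw [← Finset.card_pos, hlU.2]; omega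
    obtain ⟨i, hi⟩ := hne'
    have hiC := (hLU l hl).1 hi
    rw [Finset.mem_erase] at hiC
    have hmono : ∀ t, t ≠ 0 → t ≤ M →
        code (Function.update l P t) ≤ code (Function.update l P M) := by
      intro t ht htM
      rw [code_update_ne hl0 ht, code_update_ne hl0 hPM]
      have := Nat.pow_le_pow_right (n := 2) (by norm_num) (vt_mono (i := P) htM)
      omega
    have hzt : ∀ t, t ≠ 0 → t ≤ M → Function.update l P t ∈ A := by
      intro t ht htM
      by_contra hzA
      have hle := hmono t ht htM
      have hne2 : code (Function.update l P t) ≠ code (Function.update l P M) := by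
        intro h
        rw [code_inj h] at hzA
        exact hzA hlM
      refine hC i hiC.2 _ hlM _ (U_update_ne hlU hl0 hP ht) hzA (by omega) ?_
      rw [Function.update_of_ne hiC.1, Function.update_of_ne hiC.1]
    have hz1 : Function.update l P 1 ∉ B' := by
      intro h
      exact hlB (mem_sh.2 ⟨_, h, P, by simp, update_update_zero hl0⟩)
    obtain ⟨x, hxB, hxA'⟩ : ∃ x ∈ B', x ∉ A' := by
      by_contra hcon
      push Not at hcon
      exact hB'ne (Finset.eq_of_subset_of_card_le hcon hB'c.ge)
    have hxU := hB'.1 x hxB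
    have hxlt := (mem_Bel.1 (hB'Bel hxB)).2
    have hxA : x ∉ A := by
      intro h
      apply hxA'
      refine Finset.mem_filter.2 ⟨h, fun h2 => ?_⟩
      have := pow_le_code hPM h2
      omega
    have hxz1 : code x < code (Function.update l P 1) := by
      by_contra hcon
      exact hz1 (hB'.2 x hxB _ (U_update_ne hlU hl0 hP one_ne_zero) (not_lt.1 hcon))
    have hz1t : ∀ t, t ≠ 0 →
        code (Function.update l P 1) ≤ code (Function.update l P t) := by
      intro t ht
      rw [code_update_ne hl0 ht, code_update_ne hl0 one_ne_zero]
      have := Nat.pow_le_pow_right (n := 2) (by norm_num)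
        (vt_mono (i := P) (show 1 ≤ t by omega))
      omega
    have hxP : x P = 0 := by
      by_contra h
      have h1 : x P ≤ M := vt_le_val hPM (code_lt_pow.1 hxlt P h).le
      refine hC P hP _ (hzt _ h h1) x hxU hxA (hxz1.trans_le (hz1t _ h)) ?_
      rw [Function.update_self]
    apply hred
    refine swap_step hA hlM hxU hxA (hxz1.trans_le (hz1t M hPM)) ?_
    intro z hz
    have hzB : z ∈ sh B' := sh_mono (by simpa using hxB) hz
    have hshI := isInit_sh _ C rfl (r+1) B' hB'
    have hzl : code z < code l := by
      by_contra hcon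
      exact hlB (hshI.2 z hzB l hlU (not_lt.1 hcon))
    have hzP : z P = 0 := by
      refine sh_zero (L := {x}) ?_ z hz
      intro w hw
      rw [Finset.mem_singleton.1 hw]; exact hxP
    have hwA : Function.update z P M ∈ A := by
      by_contra hw
      refine hC P hP _ hlM _ (U_update_ne (hshI.1 z hzB) hzP hP hPM) hw ?_ ?_
      · rw [code_update_ne hl0 hPM, code_update_ne hzP hPM]
        omega
      · simp
    exact mem_sh.2 ⟨_, hwA, P, by simpa using hPM, update_update_zero hzP⟩

theorem all_T : ∀ (n : ℕ) (C : Finset (Fin N)), C.card = n → T C ∧ ∀ r, Add C r := by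
  intro n
  induction n with
  | zero =>
    intro C hC
    rw [Finset.card_eq_zero] at hC
    subst hC
    constructor
    · intro r A B hA hB hc
      rcases r with _ | _ | r
      · rw [sh_rank_zero hB.1]; simp
      · exact T_one hA hB.1 hc
      · exact T_two (C := ∅) (by simp) (by simp) _ A B rfl hA hB hc
    · intro r
      rcases r with _ | r
      · exact add_zero' _
      · exact add_empty r
  | succ n ih =>
    intro C hC
    have hih : ∀ p ∈ C, T (C.erase p) ∧ ∀ r, Add (C.erase p) r := by
      intro p hp
      apply ih
      rw [Finset.card_erase_of_mem hp, hC]; rfl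
    constructor
    · intro r A B hA hB hc
      rcases r with _ | _ | r
      · rw [sh_rank_zero hB.1]; simp
      · exact T_one hA hB.1 hc
      · exact T_two (fun p hp => (hih p hp).1) (fun p hp => (hih p hp).2 _) _ A B rfl hA hB hc
    · intro r
      rcases r with _ | r
      · exact add_zero' _
      · exact add_succ (by rw [← Finset.card_pos]; omega) (fun p hp => (hih p hp).1)
          (fun p hp => (hih p hp).2 _)

end SR

namespace SR

/-- values as natural numbers -/
def vals {k n : ℕ} (x : Fin n → Fin (k + 1)) : Fin n → ℕ := fun i => (x i : ℕ)

theorem vals_inj {k n : ℕ} : Function.Injective (vals (k := k) (n := n)) := by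
  intro x y h
  funext i
  exact Fin.ext (congrFun h i)

theorem vals_update {k n : ℕ} (x : Fin n → Fin (k + 1)) (i : Fin n) :
    vals (Function.update x i 0) = Function.update (vals x) i 0 := by
  funext j
  unfold vals
  by_cases h : j = i
  · subst h; simp
  · rw [Function.update_of_ne h, Function.update_of_ne h]

theorem vals_ne {k n : ℕ} (x : Fin n → Fin (k + 1)) (i : Fin n) : vals x i ≠ 0 ↔ x i ≠ 0 := by
  unfold vals
  rw [not_iff_not, Fin.ext_iff]
  simp

theorem supp_vals {k n : ℕ} (x : Fin n → Fin (k + 1)) :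
    supp (vals x) = Finset.univ.filter fun i => x i ≠ 0 := by
  ext i
  rw [mem_supp, vals_ne]
  simp

theorem sh_vals {k n : ℕ} (A : Finset (Fin n → Fin (k + 1))) :
    sh (A.image vals) = (dShadow A).image vals := by
  ext z
  rw [mem_sh, Finset.mem_image]
  constructor
  · rintro ⟨x, hx, i, hi, rfl⟩
    obtain ⟨y, hy, rfl⟩ := Finset.mem_image.1 hx
    refine ⟨Function.update y i 0, ?_, vals_update y i⟩
    unfold dShadow
    refine Finset.mem_biUnion.2 ⟨y, hy, Finset.mem_image.2 ⟨i, ?_, rfl⟩⟩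
    simpa using (vals_ne y i).1 hi
  · rintro ⟨w, hw, rfl⟩
    unfold dShadow at hw
    obtain ⟨y, hy, h⟩ := Finset.mem_biUnion.1 hw
    obtain ⟨i, hi, rfl⟩ := Finset.mem_image.1 h
    refine ⟨vals y, Finset.mem_image_of_mem _ hy, i, ?_, (vals_update y i).symm⟩
    exact (vals_ne y i).2 (by simpa using hi)

theorem U_vals {k n r : ℕ} {A : Finset (Fin n → Fin (k + 1))}
    (hA : ∀ x ∈ A, (Finset.univ.filter fun i => x i ≠ 0).card = r) :
    ∀ x ∈ A.image vals, U Finset.univ r x := by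
  intro x hx
  obtain ⟨y, hy, rfl⟩ := Finset.mem_image.1 hx
  exact ⟨Finset.subset_univ _, by rw [supp_vals]; exact hA y hy⟩

theorem plt_of_code {k n : ℕ} {x y : Fin n → Fin (k + 1)}
    (hc : (Finset.univ.filter fun i => x i ≠ 0).card = (Finset.univ.filter fun i => y i ≠ 0).card)
    (h : code (vals x) < code (vals y)) : plt x y := by
  rw [code_eq, code_eq, Finset.geomSum_lt_geomSum_iff_toColex_lt_toColex le_rfl,
    Finset.Colex.lt_iff_exists_filter_lt] at h
  obtain ⟨q, hq, hfil⟩ := h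
  rw [Finset.mem_sdiff] at hq
  obtain ⟨hqy, hqx⟩ := hq
  obtain ⟨p, hp, rfl⟩ := mem_vset.1 hqy
  rw [vt_mem_vset hp] at hqx
  set m := vals y p with hm
  have key : ∀ (i : Fin n) (j : ℕ), j ≠ 0 → vt p m < vt i j → (vals x i = j ↔ vals y i = j) := by
    intro i j hj hlt
    rw [← vt_mem_vset hj, ← vt_mem_vset hj]
    have := Finset.ext_iff.1 hfil (vt i j)
    simp only [Finset.mem_filter, hlt, and_true] at this
    exact this
  have hmem : ∀ (w : Fin n → Fin (k + 1)) (i : Fin n) (j : ℕ), i ∈ rset w j ↔ vals w i = j := by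
    intro w i j
    simp [rset, vals]
  have hr0 : ∀ w : Fin n → Fin (k + 1),
      (rset w 0).card + (Finset.univ.filter fun i => w i ≠ 0).card = n := by
    intro w
    have e : rset w 0 = Finset.univ.filter fun i => w i = 0 := by
      ext i
      have := vals_ne w i
      rw [not_iff_not] at this
      rw [hmem, this]; simp
    rw [e]
    have := Finset.card_filter_add_card_filter_not (s := (Finset.univ : Finset (Fin n)))
      (fun i => w i = 0)
    simpa using this
  right
  refine ⟨by have := hr0 x; have := hr0 y; omega, m, ⟨p, ?_, ?_, ?_⟩, ?_⟩
  · rw [hmem]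
  · rw [hmem]; exact hqx
  · intro j hj
    rw [hmem, hmem] at hj
    by_contra hcon
    have : vt p m < vt j m := by
      unfold vt
      have h1 : (p : ℕ) < j := not_le.1 hcon
      omega
    have := key j m hp this
    tauto
  · intro j hj
    ext i
    rw [hmem, hmem]
    exact key i j (by omega) (vt_lt hp hj)

theorem isInit_vals {k n r : ℕ} {B : Finset (Fin n → Fin (k + 1))}
    (hBrank : ∀ x ∈ B, (Finset.univ.filter fun i => x i ≠ 0).card = r)
    (hB : ∀ y ∈ B, ∀ x : Fin n → Fin (k + 1),
      (Finset.univ.filter fun i => x i ≠ 0).card = r → ple x y → x ∈ B) :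
    IsInit Finset.univ r (B.image vals) := by
  refine ⟨U_vals hBrank, ?_⟩
  intro y' hy' x hx hle
  obtain ⟨y, hy, rfl⟩ := Finset.mem_image.1 hy'
  have hbd : ∀ i, x i < k + 1 := by
    intro i
    by_cases hi : x i = 0
    · omega
    have h1 := pow_le_code hi rfl
    have hne : (supp (vals y)).Nonempty := by
      rw [Finset.nonempty_iff_ne_empty]
      intro he
      have : code (vals y) = 0 := by unfold code; rw [he]; simp
      have h2 : 0 < 2 ^ vt i (x i) := by positivity
      omega
    obtain ⟨p, hp, h2, h3⟩ := exists_top hne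
    have h4 : 2 ^ vt i (x i) < 2 ^ (vt p (vals y p) + 1) := by omega
    have h5 := (Nat.pow_lt_pow_iff_right (by norm_num)).1 h4
    have h6 := vt_le_val hp (show vt i (x i) ≤ vt p (vals y p) by omega)
    have h7 : vals y p < k + 1 := (y p).2
    omega
  set x' : Fin n → Fin (k + 1) := fun i => ⟨x i, hbd i⟩ with hx'
  have hxx : vals x' = x := rfl
  refine Finset.mem_image.2 ⟨x', ?_, hxx⟩
  have hxr : (Finset.univ.filter fun i => x' i ≠ 0).card = r := by
    rw [← supp_vals, hxx]; exact hx.2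
  refine hB y hy x' hxr ?_
  rcases hle.lt_or_eq with h | h
  · exact Or.inr (plt_of_code (by rw [hxr, hBrank y hy]) (by rwa [hxx]))
  · exact Or.inl (vals_inj (by rw [hxx]; exact code_inj h))

end SR

/-- **Theorem 2.** Let `k ≥ 1`, `n ≥ 1`, `0 ≤ r ≤ n`, let `A ⊆ [k]^n_r` and let `B` be an
initial segment of the restriction of the `≤`-order to `[k]^n_r` with `|B| = |A|`.
Then `|d(A)| ≥ |d(B)|`. (`[k]^n_r` is the set of points with exactly `r` nonzero
coordinates; the alphabet `[k]` with `k ≥ 1` is rendered as `Fin (k+1)`.) -/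
theorem thm_shadow_rank (k n r : ℕ) (hn : 1 ≤ n) (hr : r ≤ n)
    (A B : Finset (Fin n → Fin (k + 1)))
    (hA : ∀ x ∈ A, (Finset.univ.filter fun i => x i ≠ 0).card = r)
    (hBrank : ∀ x ∈ B, (Finset.univ.filter fun i => x i ≠ 0).card = r)
    (hB : ∀ y ∈ B, ∀ x : Fin n → Fin (k + 1),
      (Finset.univ.filter fun i => x i ≠ 0).card = r → ple x y → x ∈ B)
    (hcard : B.card = A.card) :
    (dShadow B).card ≤ (dShadow A).card := by
  have h := (SR.all_T _ (Finset.univ : Finset (Fin n)) rfl).1 r (A.image SR.vals) (B.image SR.vals)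
    (SR.U_vals hA) (SR.isInit_vals hBrank hB)
    (by rw [Finset.card_image_of_injective _ SR.vals_inj,
      Finset.card_image_of_injective _ SR.vals_inj, hcard])
  rwa [SR.sh_vals, SR.sh_vals, Finset.card_image_of_injective _ SR.vals_inj,
    Finset.card_image_of_injective _ SR.vals_inj] at h
end
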